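/- Suppose K ⊂ ℝ^d (d ≥ 2) is a continuum of diameter 1, K = W ∪ E with H¹(E) < ∞ and H¹(W) > 0, and K is mean wiggly at every point of W with uniform parameters λ, κ, β₀ ∈ (0,1). Then dim_H(K) ≥ 1 + c'·λ⁴·β₀²·κ for a universal constant c' > 0. -/

import Mathlib

open Metric MeasureTheory Filter Set

noncomputable section

/-- An affine line in a real normed space. -/
def IsLine {E : Type*} [NormedAddCommGroup E] [NormedSpace ℝ E] (L : Set E) : Prop :=
  ∃ a v : E, v ≠ 0 ∧ L = {p | ∃ t : ℝ, p = a + t • v}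

/-- The Jones `β`-number of `K` at `x` and scale `r`:
`inf` over affine lines `L` of `sup_{z ∈ K ∩ B(x,r)} dist(z, L) / r`. -/
noncomputable def betaNum {E : Type*} [NormedAddCommGroup E] [NormedSpace ℝ E]
    (K : Set E) (x : E) (r : ℝ) : ℝ :=
  sInf ((fun L => sSup ((fun z => infDist z L) '' (K ∩ closedBall x r)) / r) ''
    {L : Set E | IsLine L})

/-- `K` is mean wiggly at `x` with parameters `λ, κ, β₀`: there is `r(x) > 0` such
that whenever `λⁿ < r(x)`, the number of scales `m < n` with `β_K(x,λ^m) ≥ β₀`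
exceeds `κ·n`. -/
def MeanWiggly {E : Type*} [NormedAddCommGroup E] [NormedSpace ℝ E]
    (K : Set E) (x : E) (lam κ β₀ : ℝ) : Prop :=
  ∃ r₀ : ℝ, 0 < r₀ ∧ ∀ n : ℕ, lam ^ n < r₀ →
    κ * n < ((Finset.range n).filter (fun m => β₀ ≤ betaNum K x (lam ^ m))).card

/-! ### Second differences of a discrete curve -/

section Curve

variable {V : Type*} [NormedAddCommGroup V] [InnerProductSpace ℝ V]

/-- The second difference of step `h` of a sequence `γ` at `a`. -/
def secDiff (γ : ℕ → V) (h a : ℕ) : V := γ (a + 2 * h) - (2 : ℝ) • γ (a + h) + γ a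

/-- A bound for the distance between `γ` on the window `[a, a + 2 ^ M]` and the affine
interpolation of `γ` between the ends of the window. -/
def devBound (γ : ℕ → V) : ℕ → ℕ → ℝ
  | 0, _ => 0
  | M + 1, a => max (devBound γ M a) (devBound γ M (a + 2 ^ M)) + ‖secDiff γ (2 ^ M) a‖ / 2

lemma devBound_nonneg (γ : ℕ → V) (M a : ℕ) : 0 ≤ devBound γ M a := by
  induction M generalizing a with
  | zero => simp [devBound]
  | succ M ih =>
    have := ih a
    simp only [devBound]
    positivity

lemma norm_sub_interpolation_le_devBound (γ : ℕ → V) (M a u : ℕ) (hu : u ≤ 2 ^ M) :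
    ‖γ (a + u) - (γ a + ((u : ℝ) / 2 ^ M) • (γ (a + 2 ^ M) - γ a))‖ ≤ devBound γ M a := by
  induction M generalizing a u with
  | zero =>
    simp only [devBound]
    have : u = 0 ∨ u = 1 := by simp at hu; omega
    rcases this with rfl | rfl <;> simp
  | succ M ih =>
    have h2 : (0 : ℝ) < 2 ^ M := by positivity
    have e2 : a + 2 ^ (M + 1) = a + 2 * 2 ^ M := by ring
    rcases le_total u (2 ^ M) with h | h
    · have key : γ (a + u) - (γ a + ((u : ℝ) / 2 ^ (M + 1)) • (γ (a + 2 ^ (M + 1)) - γ a))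
          = (γ (a + u) - (γ a + ((u : ℝ) / 2 ^ M) • (γ (a + 2 ^ M) - γ a)))
            + (-((u : ℝ) / 2 ^ M / 2)) • secDiff γ (2 ^ M) a := by
        have e4 : (u : ℝ) / 2 ^ (M + 1) = (u : ℝ) / 2 ^ M / 2 := by
          rw [pow_succ]; field_simp
        rw [e4, e2]
        simp only [secDiff]
        module
      rw [key]
      refine (norm_add_le _ _).trans ?_
      simp only [devBound]
      refine add_le_add ((ih a u h).trans (le_max_left _ _)) ?_
      rw [norm_smul, norm_neg, Real.norm_of_nonneg (by positivity)]
      have : (u : ℝ) / 2 ^ M ≤ 1 := by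
        rw [div_le_one h2]; exact_mod_cast h
      nlinarith [norm_nonneg (secDiff γ (2 ^ M) a)]
    · obtain ⟨v, rfl⟩ := Nat.exists_eq_add_of_le h
      have hv : v ≤ 2 ^ M := by rw [pow_succ] at hu; omega
      have e3 : a + 2 ^ M + 2 ^ M = a + 2 * 2 ^ M := by ring
      have key : γ (a + (2 ^ M + v))
          - (γ a + (((2 ^ M + v : ℕ) : ℝ) / 2 ^ (M + 1)) • (γ (a + 2 ^ (M + 1)) - γ a))
          = (γ (a + 2 ^ M + v) - (γ (a + 2 ^ M)
              + ((v : ℝ) / 2 ^ M) • (γ (a + 2 ^ M + 2 ^ M) - γ (a + 2 ^ M))))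
            + (-((1 - (v : ℝ) / 2 ^ M) / 2)) • secDiff γ (2 ^ M) a := by
        have e4 : (((2 ^ M + v : ℕ) : ℝ) / 2 ^ (M + 1)) = (1 + (v : ℝ) / 2 ^ M) / 2 := by
          push_cast; field_simp; ring
        rw [e4]
        simp only [secDiff, e2, e3, ← add_assoc]
        module
      rw [key]
      refine (norm_add_le _ _).trans ?_
      simp only [devBound]
      refine add_le_add ((ih _ v hv).trans (le_max_right _ _)) ?_
      have h1 : (v : ℝ) / 2 ^ M ≤ 1 := by
        rw [div_le_one h2]; exact_mod_cast hv
      have h0 : 0 ≤ (v : ℝ) / 2 ^ M := by positivity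
      rw [norm_smul, norm_neg, Real.norm_of_nonneg (by linarith)]
      nlinarith [norm_nonneg (secDiff γ (2 ^ M) a)]

lemma sum_range_add_le {F : ℕ → ℝ} {N : ℕ} (h0 : ∀ n, 0 ≤ F n) (hN : ∀ n, N ≤ n → F n = 0)
    (h : ℕ) : ∑ a ∈ Finset.range N, F (a + h) ≤ ∑ a ∈ Finset.range N, F a := by
  have h1 : ∑ a ∈ Finset.range N, F (a + h) ≤ ∑ a ∈ Finset.range (N + h), F a := by
    rw [add_comm N h, Finset.sum_range_add]
    simp only [add_comm h]
    exact le_add_of_nonneg_left (Finset.sum_nonneg fun i _ => h0 i)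
  refine h1.trans (le_of_eq ?_)
  rw [Finset.sum_range_add]
  simp [hN]

lemma sum_sq_secDiff_le {γ : ℕ → V} {N : ℕ} (hN : ∀ n, N ≤ n → γ n = γ N) (Q : ℕ) :
    ∑ M ∈ Finset.range Q, (∑ a ∈ Finset.range N, ‖secDiff γ (2 ^ M) a‖ ^ 2) / 4 ^ (M + 1)
      ≤ ∑ a ∈ Finset.range N, ‖γ (a + 1) - γ a‖ ^ 2 := by
  set g : ℕ → ℝ := fun h => ∑ a ∈ Finset.range N, ‖γ (a + h) - γ a‖ ^ 2 with hg
  have step : ∀ h, g (2 * h) + ∑ a ∈ Finset.range N, ‖secDiff γ h a‖ ^ 2 ≤ 4 * g h := by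
    intro h
    have h1 := sum_range_add_le (F := fun a => ‖γ (a + h) - γ a‖ ^ 2) (N := N)
      (fun n => by positivity) (fun n hn => by simp [hN n hn, hN (n + h) (by omega)]) h
    have h2 : g (2 * h) + ∑ a ∈ Finset.range N, ‖secDiff γ h a‖ ^ 2
        = 2 * ∑ a ∈ Finset.range N, ‖γ (a + h + h) - γ (a + h)‖ ^ 2 + 2 * g h := by
      simp only [hg, Finset.mul_sum, ← Finset.sum_add_distrib]
      refine Finset.sum_congr rfl fun a _ => ?_
      have := parallelogram_law_with_norm ℝ (γ (a + h + h) - γ (a + h)) (γ (a + h) - γ a)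
      have e1 : γ (a + h + h) - γ (a + h) + (γ (a + h) - γ a) = γ (a + 2 * h) - γ a := by
        rw [show a + h + h = a + 2 * h by ring]; abel
      have e2 : γ (a + h + h) - γ (a + h) - (γ (a + h) - γ a) = secDiff γ h a := by
        rw [show a + h + h = a + 2 * h by ring, secDiff]; module
      rw [e1, e2] at this
      nlinarith
    rw [h2]
    have h1' : ∑ a ∈ Finset.range N, ‖γ (a + h + h) - γ (a + h)‖ ^ 2 ≤ g h := h1
    linarith
  have tele : ∀ Q, g (2 ^ Q) / 4 ^ Q + ∑ M ∈ Finset.range Q,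
      (∑ a ∈ Finset.range N, ‖secDiff γ (2 ^ M) a‖ ^ 2) / 4 ^ (M + 1) ≤ g 1 := by
    intro Q
    induction Q with
    | zero => simp
    | succ Q ih =>
      rw [Finset.sum_range_succ]
      have := step (2 ^ Q)
      have h4 : (0 : ℝ) < 4 ^ (Q + 1) := by positivity
      have : g (2 ^ (Q + 1)) / 4 ^ (Q + 1)
          + (∑ a ∈ Finset.range N, ‖secDiff γ (2 ^ Q) a‖ ^ 2) / 4 ^ (Q + 1)
          ≤ g (2 ^ Q) / 4 ^ Q := by
        rw [← add_div, div_le_div_iff₀ h4 (by positivity), pow_succ' 2 Q, pow_succ' (4 : ℝ) Q]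
        nlinarith [pow_pos (show (0 : ℝ) < 4 by norm_num) Q]
      linarith
  have := tele Q
  have h0 : 0 ≤ g (2 ^ Q) / 4 ^ Q := by
    simp only [hg]; positivity
  linarith

lemma devBound_eq_zero {γ : ℕ → V} {N : ℕ} (hN : ∀ n, N ≤ n → γ n = γ N) (M a : ℕ)
    (ha : N ≤ a) : devBound γ M a = 0 := by
  induction M generalizing a with
  | zero => rfl
  | succ M ih =>
    have h0 : secDiff γ (2 ^ M) a = 0 := by
      rw [secDiff, hN a ha, hN _ (ha.trans (Nat.le_add_right _ _)),
        hN _ (ha.trans (Nat.le_add_right _ _))]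
      module
    simp [devBound, ih a ha, ih _ (ha.trans (Nat.le_add_right a (2 ^ M))), h0]

lemma sum_sq_devBound_le {γ : ℕ → V} {N : ℕ} (hN : ∀ n, N ≤ n → γ n = γ N) (Q : ℕ) :
    ∑ M ∈ Finset.range Q, (∑ a ∈ Finset.range N, devBound γ M a ^ 2) / 4 ^ M
      ≤ 3 * ∑ a ∈ Finset.range N, ‖γ (a + 1) - γ a‖ ^ 2 := by
  set X : ℕ → ℝ := fun M => ∑ a ∈ Finset.range N, devBound γ M a ^ 2 with hX
  set D : ℕ → ℝ := fun M => ∑ a ∈ Finset.range N, ‖secDiff γ (2 ^ M) a‖ ^ 2 with hD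
  have step : ∀ M, X (M + 1) ≤ 3 * X M + 3 / 4 * D M := by
    intro M
    have h1 := sum_range_add_le (F := fun a => devBound γ M a ^ 2) (N := N)
      (fun n => by positivity) (fun n hn => by simp [devBound_eq_zero hN M n hn]) (2 ^ M)
    have h2 : X (M + 1) ≤ 3 / 2 * (X M + ∑ a ∈ Finset.range N, devBound γ M (a + 2 ^ M) ^ 2)
        + 3 / 4 * D M := by
      simp only [hX, hD, Finset.mul_sum, ← Finset.sum_add_distrib]
      refine Finset.sum_le_sum fun a _ => ?_
      simp only [devBound]
      have ha := devBound_nonneg γ M a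
      have hb := devBound_nonneg γ M (a + 2 ^ M)
      set m := max (devBound γ M a) (devBound γ M (a + 2 ^ M)) with hm
      have hm2 : m ^ 2 ≤ devBound γ M a ^ 2 + devBound γ M (a + 2 ^ M) ^ 2 := by
        rcases max_choice (devBound γ M a) (devBound γ M (a + 2 ^ M)) with h | h <;>
        · rw [hm, h]; nlinarith
      nlinarith [sq_nonneg (m - ‖secDiff γ (2 ^ M) a‖)]
    have h1' : ∑ a ∈ Finset.range N, devBound γ M (a + 2 ^ M) ^ 2 ≤ X M := h1
    linarith
  have tele : ∀ Q, 4 * (X Q / 4 ^ Q) + ∑ M ∈ Finset.range Q, X M / 4 ^ M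
      ≤ 3 * ∑ M ∈ Finset.range Q, D M / 4 ^ (M + 1) := by
    intro Q
    induction Q with
    | zero => simp [hX, devBound]
    | succ Q ih =>
      rw [Finset.sum_range_succ, Finset.sum_range_succ, mul_add]
      have h4 : (0 : ℝ) < 4 ^ Q := by positivity
      have : X (Q + 1) / 4 ^ (Q + 1) ≤ 3 / 4 * (X Q / 4 ^ Q) + 3 / 4 * (D Q / 4 ^ (Q + 1)) := by
        have e : 3 / 4 * (X Q / 4 ^ Q) + 3 / 4 * (D Q / 4 ^ (Q + 1))
            = (3 * X Q + 3 / 4 * D Q) / 4 ^ (Q + 1) := by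
          rw [pow_succ]; field_simp
        rw [e]
        exact div_le_div_of_nonneg_right (step Q) (by positivity)
      linarith
  have h1 := tele Q
  have h2 := sum_sq_secDiff_le hN Q
  have h3 : 0 ≤ X Q / 4 ^ Q := by simp only [hX]; positivity
  linarith

end Curve

/-! ### Geodesics for a cost on the edges of a graph -/

section Geodesic

lemma exists_walk_of_reflTransGen {ι : Type*} {R : ι → ι → Prop} {e f : ι}
    (h : Relation.ReflTransGen R e f) :
    ∃ (a : ℕ → ι) (M : ℕ), a 0 = e ∧ a M = f ∧ ∀ u < M, R (a u) (a (u + 1)) := by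
  induction h with
  | refl => exact ⟨fun _ => e, 0, rfl, rfl, by simp⟩
  | @tail b c _ hbc ih =>
    obtain ⟨a, M, h0, hM, hR⟩ := ih
    refine ⟨fun u => if u ≤ M then a u else c, M + 1, by simp [h0], by simp, fun u hu => ?_⟩
    rcases Nat.lt_succ_iff_lt_or_eq.1 hu with h | rfl
    · simpa [h.le, Nat.succ_le_of_lt h] using hR u h
    · simpa [hM] using hbc

/-- A walk of minimal cost from `e` to `T` is geodesic along every permitted shortcut. -/
lemma exists_geodesic {ι : Type*} (R : ι → ι → Prop) (c : ι → ι → ℕ) (e : ι) (T : Set ι)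
    (h : ∃ f ∈ T, Relation.ReflTransGen R e f) :
    ∃ (a : ℕ → ι) (M : ℕ), a 0 = e ∧ a M ∈ T ∧ (∀ u < M, R (a u) (a (u + 1))) ∧
      (∀ s t, s < t → t ≤ M → R (a s) (a t) →
        ∑ u ∈ Finset.range t, c (a u) (a (u + 1))
          ≤ ∑ u ∈ Finset.range s, c (a u) (a (u + 1)) + c (a s) (a t)) ∧
      ∀ (a' : ℕ → ι) (M' : ℕ), a' 0 = e → a' M' ∈ T → (∀ u < M', R (a' u) (a' (u + 1))) →
        ∑ u ∈ Finset.range M, c (a u) (a (u + 1))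
          ≤ ∑ u ∈ Finset.range M', c (a' u) (a' (u + 1)) := by
  classical
  let Good : (ℕ → ι) × ℕ → Prop := fun w =>
    w.1 0 = e ∧ w.1 w.2 ∈ T ∧ ∀ u < w.2, R (w.1 u) (w.1 (u + 1))
  let cost : (ℕ → ι) × ℕ → ℕ := fun w => ∑ u ∈ Finset.range w.2, c (w.1 u) (w.1 (u + 1))
  have hex : ∃ n, ∃ w, Good w ∧ cost w = n := by
    obtain ⟨f, hf, hef⟩ := h
    obtain ⟨a, M, h0, hM, hR⟩ := exists_walk_of_reflTransGen hef
    exact ⟨_, (a, M), ⟨h0, by simpa [hM] using hf, hR⟩, rfl⟩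
  obtain ⟨⟨a, M⟩, ⟨h0, hM, hR⟩, hc⟩ := Nat.find_spec hex
  simp only at h0 hM hR
  have hmin : ∀ (a' : ℕ → ι) (M' : ℕ), a' 0 = e → a' M' ∈ T →
      (∀ u < M', R (a' u) (a' (u + 1))) →
        ∑ u ∈ Finset.range M, c (a u) (a (u + 1))
          ≤ ∑ u ∈ Finset.range M', c (a' u) (a' (u + 1)) := by
    intro a' M' h0' hM' hR'
    have : Nat.find hex ≤ cost (a', M') := Nat.find_min' hex ⟨(a', M'), ⟨h0', hM', hR'⟩, rfl⟩
    rw [← hc] at this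
    exact this
  refine ⟨a, M, h0, hM, hR, fun s t hst htM hRst => ?_, hmin⟩
  obtain ⟨d, rfl⟩ : ∃ d, t = s + 1 + d := Nat.exists_eq_add_of_le hst
  obtain ⟨l, rfl⟩ : ∃ l, M = s + 1 + d + l := Nat.exists_eq_add_of_le htM
  let a' : ℕ → ι := fun u => if u ≤ s then a u else a (u + d)
  have ha1 : ∀ u, u ≤ s → a' u = a u := fun u hu => by simp [a', hu]
  have ha2 : ∀ u, a' (s + 1 + u) = a (s + 1 + d + u) := fun u => by
    have : ¬ s + 1 + u ≤ s := by omega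
    simp only [a', this, if_false]
    congr 1; omega
  have ha3 : a' (s + 1) = a (s + 1 + d) := ha2 0
  have key := hmin a' (s + 1 + l) (by rw [ha1 0 (Nat.zero_le _), h0]) (by rw [ha2]; exact hM) (by
    intro u hu
    rcases lt_trichotomy u s with h | rfl | h
    · rw [ha1 u h.le, ha1 (u + 1) h]
      exact hR u (by omega)
    · rw [ha1 u le_rfl, ha3]; exact hRst
    · obtain ⟨v, rfl⟩ : ∃ v, u = s + 1 + v := Nat.exists_eq_add_of_le h
      rw [ha2, add_assoc (s + 1) v 1, ha2]
      exact hR _ (by omega))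
  have e1 : ∑ u ∈ Finset.range s, c (a' u) (a' (u + 1))
      = ∑ u ∈ Finset.range s, c (a u) (a (u + 1)) :=
    Finset.sum_congr rfl fun u hu => by
      have := Finset.mem_range.1 hu
      rw [ha1 u this.le, ha1 (u + 1) this]
  have e2 : ∑ u ∈ Finset.range l, c (a' (s + 1 + u)) (a' (s + 1 + u + 1))
      = ∑ u ∈ Finset.range l, c (a (s + 1 + d + u)) (a (s + 1 + d + u + 1)) :=
    Finset.sum_congr rfl fun u _ => by
      rw [ha2, add_assoc (s + 1) u 1, ha2, ← add_assoc (s + 1 + d)]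
  have e3 := Finset.sum_range_add (fun u => c (a' u) (a' (u + 1))) (s + 1) l
  have e4 := Finset.sum_range_add (fun u => c (a u) (a (u + 1))) (s + 1 + d) l
  rw [Finset.sum_range_succ, e1, e2, ha1 s le_rfl, ha3] at e3
  omega

end Geodesic

/-! ### Connectedness and coverings by balls -/

section Connected

variable {V : Type*} [MetricSpace V]

lemma exists_chain_of_isPreconnected {ι : Type*} [Fintype ι] {K : Set V}
    (hc : IsPreconnected K) {x : V} (hx : x ∈ K) {r : ℝ} (hr : 0 < r)
    (hout : ∃ y ∈ K, r < dist y x) {p : ι → V} {ρ : ι → ℝ}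
    (hρr : ∀ e, ρ e ≤ r / 1000)
    (hcov : ∀ y ∈ K, dist y x ≤ r / 2 → ∃ e, dist y (p e) ≤ 10 * ρ e) :
    ∃ e f : ι, dist x (p e) ≤ 10 * ρ e ∧ r / 4 ≤ dist (p f) x ∧
      Relation.ReflTransGen (fun e f => dist (p e) (p f) ≤ 10 * (ρ e + ρ f) ∧
        dist (p e) x ≤ 3 * r / 8 ∧ dist (p f) x ≤ 3 * r / 8) e f := by
  set R : ι → ι → Prop := fun e f => dist (p e) (p f) ≤ 10 * (ρ e + ρ f) ∧
        dist (p e) x ≤ 3 * r / 8 ∧ dist (p f) x ≤ 3 * r / 8 with hR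
  obtain ⟨e₀, he₀⟩ := hcov x hx (by simp; positivity)
  by_contra hcon
  push Not at hcon
  have hfar : ∀ f, Relation.ReflTransGen R e₀ f → dist (p f) x < r / 4 := fun f hf => by
    by_contra h
    exact hcon e₀ f he₀ (not_lt.1 h) hf
  set S : Set ι := {f | Relation.ReflTransGen R e₀ f} with hS
  set S' : Set ι := {f | ¬ Relation.ReflTransGen R e₀ f ∧ dist (p f) x ≤ 3 * r / 8} with hS'
  have hcl : ∀ S : Set ι, IsClosed (⋃ e ∈ S, closedBall (p e) (10 * ρ e)) := fun S =>
    (Set.toFinite S).isClosed_biUnion fun e _ => isClosed_closedBall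
  have hcl' : IsClosed ((⋃ e ∈ S', closedBall (p e) (10 * ρ e)) ∪ {y | 5 * r / 16 ≤ dist y x}) :=
    (hcl S').union (isClosed_le continuous_const (continuous_id.dist continuous_const))
  obtain ⟨y, hyK, hy1, hy2⟩ := isPreconnected_closed_iff.1 hc _ _ (hcl S) hcl' (by
      intro y hy
      by_cases h5 : 5 * r / 16 ≤ dist y x
      · exact Or.inr (Or.inr h5)
      · obtain ⟨e, he⟩ := hcov y hy (by linarith)
        by_cases heS : Relation.ReflTransGen R e₀ e
        · exact Or.inl (mem_biUnion (x := e) heS he)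
        · refine Or.inr (Or.inl (mem_biUnion (x := e) ⟨heS, ?_⟩ he))
          have := dist_triangle_left (p e) x y
          linarith [hρr e])
    ⟨x, hx, mem_biUnion (x := e₀) (Relation.ReflTransGen.refl) he₀⟩ (by
      obtain ⟨y, hy, hyr⟩ := hout
      exact ⟨y, hy, Or.inr (by simp only [mem_ofPred_eq]; linarith)⟩)
  simp only [mem_iUnion, mem_closedBall] at hy1
  obtain ⟨e, heS, hye⟩ := hy1
  have hex := hfar e heS
  rcases hy2 with hy2 | hy2
  · simp only [mem_iUnion, mem_closedBall] at hy2
    obtain ⟨f, ⟨hf1, hf2⟩, hyf⟩ := hy2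
    refine hf1 (heS.tail ⟨?_, by linarith, hf2⟩)
    have := dist_triangle_left (p e) (p f) y
    linarith
  · simp only [mem_ofPred_eq] at hy2
    have := dist_triangle y (p e) x
    linarith [hρr e]

lemma le_sum_radii_of_isPreconnected {ι : Type*} {K : Set V} (hc : IsPreconnected K) {z : V}
    (hz : z ∈ K) {σ : ℝ} (hout : ∃ y ∈ K, σ < dist y z) (F : Finset ι) {p : ι → V} {ρ : ι → ℝ}
    (hρ : ∀ e, 0 ≤ ρ e) (hcov : ∀ y ∈ K, dist y z ≤ σ → ∃ e ∈ F, dist y (p e) ≤ ρ e) :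
    σ ≤ ∑ e ∈ F, 2 * ρ e := by
  have hsub : Icc 0 σ ⊆ ⋃ e ∈ F, closedBall (dist (p e) z) (ρ e) := by
    intro s hs
    obtain ⟨y, hy, hyσ⟩ := hout
    have := hc.intermediate_value hz hy (f := fun y => dist y z) (by fun_prop)
    obtain ⟨w, hw, hws⟩ := this (show s ∈ Icc (dist z z) (dist y z) from
      ⟨by simpa using hs.1, by linarith [hs.2]⟩)
    obtain ⟨e, he, hwe⟩ := hcov w hw (by simp only at hws; linarith [hs.2])
    refine mem_biUnion (x := e) he ?_
    rw [mem_closedBall, Real.dist_eq, ← hws]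
    exact (abs_dist_sub_le w (p e) z).trans hwe
  have h1 := (measure_mono (μ := volume) hsub).trans (measure_biUnion_finset_le F _)
  simp only [Real.volume_Icc, Real.volume_closedBall, sub_zero] at h1
  rw [← ENNReal.ofReal_sum_of_nonneg (fun e _ => by have := hρ e; positivity)] at h1
  exact (ENNReal.ofReal_le_ofReal_iff (Finset.sum_nonneg fun e _ => by
    have := hρ e; positivity)).1 h1

end Connected

lemma sum_le_of_pairwise_add_le_abs {ι : Type*} (S : Finset ι) {R t : ι → ℝ} {X D : ℝ}
    (hR : ∀ i ∈ S, 0 ≤ R i) (hRD : ∀ i ∈ S, R i ≤ D)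
    (hsep : ∀ i ∈ S, ∀ j ∈ S, i ≠ j → R i + R j ≤ |t i - t j|)
    (hX : ∀ i ∈ S, ∀ j ∈ S, |t i - t j| ≤ X) (hXD : 0 ≤ X + D) : ∑ i ∈ S, R i ≤ X + D := by
  rcases S.eq_empty_or_nonempty with rfl | ⟨i₀, hi₀⟩
  · simpa using hXD
  have hdis : (S : Set ι).PairwiseDisjoint fun i => ball (t i) (R i) := by
    intro i hi j hj hij
    exact ball_disjoint_ball (by simpa [Real.dist_eq] using hsep i hi j hj hij)
  have hsub : (⋃ i ∈ S, ball (t i) (R i)) ⊆ closedBall (t i₀) (X + D) := by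
    intro y hy
    simp only [mem_iUnion, mem_ball] at hy
    obtain ⟨i, hi, hy⟩ := hy
    have h1 := hX i hi i₀ hi₀
    rw [← Real.dist_eq] at h1
    have := dist_triangle y (t i) (t i₀)
    rw [mem_closedBall]
    linarith [hRD i hi]
  have h1 := measure_mono (μ := volume) hsub
  rw [measure_biUnion_finset hdis fun i _ => measurableSet_ball] at h1
  simp only [Real.volume_ball, Real.volume_closedBall] at h1
  rw [← ENNReal.ofReal_sum_of_nonneg (fun e he => by have := hR e he; positivity),
    ENNReal.ofReal_le_ofReal_iff (by positivity), ← Finset.mul_sum] at h1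
  linarith

lemma exists_interpolating_sequence {V : Type*} [NormedAddCommGroup V] [NormedSpace ℝ V]
    (P : ℕ → V) (c : ℕ → ℕ) {ε : ℝ} (hε : 0 ≤ ε) (M : ℕ)
    (hP : ∀ u < M, dist (P u) (P (u + 1)) ≤ ε * c u) :
    ∃ γ : ℕ → V, (∀ n, ‖γ (n + 1) - γ n‖ ≤ ε) ∧
      (∀ t ≤ M, γ (∑ u ∈ Finset.range t, c u) = P t) ∧
      ∀ n, ∑ u ∈ Finset.range M, c u ≤ n → γ n = P M := by
  induction M with
  | zero => exact ⟨fun _ => P 0, by simp [hε], by simp, by simp⟩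
  | succ M ih =>
    obtain ⟨γ, h1, h2, h3⟩ := ih fun u hu => hP u (by omega)
    set m := ∑ u ∈ Finset.range M, c u with hm
    set w := P (M + 1) - P M with hw
    have hwn : ‖w‖ ≤ ε * c M := by
      have := hP M (by omega)
      rwa [dist_comm, dist_eq_norm] at this
    by_cases hc0 : c M = 0
    · have hw0 : P (M + 1) = P M := by
        have : ‖w‖ ≤ 0 := by simpa [hc0] using hwn
        exact sub_eq_zero.1 (norm_le_zero_iff.1 this)
      refine ⟨γ, h1, fun t ht => ?_, fun n hn => ?_⟩
      · rcases Nat.le_succ_iff.1 ht with h | rfl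
        · exact h2 t h
        · rw [Finset.sum_range_succ, hc0, add_zero, h2 M le_rfl, Nat.succ_eq_add_one, hw0]
      · rw [Finset.sum_range_succ, hc0, add_zero] at hn
        rw [h3 n hn, hw0]
    have hc : (0 : ℝ) < c M := by exact_mod_cast Nat.pos_of_ne_zero hc0
    set φ : ℕ → ℝ := fun n => min 1 (((n - m : ℕ) : ℝ) / c M) with hφ
    have hφ0 : φ m = 0 := by simp [hφ]
    have hφs : ∀ n, |φ (n + 1) - φ n| ≤ 1 / c M := by
      intro n
      have a1 : (((n + 1 - m : ℕ) : ℝ) / c M) ≤ ((n - m : ℕ) : ℝ) / c M + 1 / c M := by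
        rw [← add_div]
        refine div_le_div_of_nonneg_right ?_ hc.le
        have : n + 1 - m ≤ n - m + 1 := by omega
        exact_mod_cast this
      have a2 : ((n - m : ℕ) : ℝ) / c M ≤ (((n + 1 - m : ℕ) : ℝ) / c M) := by
        refine div_le_div_of_nonneg_right ?_ hc.le
        have : n - m ≤ n + 1 - m := by omega
        exact_mod_cast this
      have a3 : 0 < 1 / (c M : ℝ) := by positivity
      have b1 : φ n ≤ φ (n + 1) := min_le_min le_rfl a2
      have b2 : φ (n + 1) ≤ φ n + 1 / c M := by
        simp only [hφ]
        rw [← min_add_add_right]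
        exact min_le_min (by linarith) a1
      rw [abs_of_nonneg (by linarith)]
      linarith
    have hφ1 : ∀ n, m + c M ≤ n → φ n = 1 := fun n hn => by
      refine min_eq_left ?_
      rw [le_div_iff₀ hc, one_mul]
      have : c M ≤ n - m := by omega
      exact_mod_cast this
    refine ⟨fun n => if n ≤ m then γ n else P M + φ n • w, fun n => ?_, fun t ht => ?_,
      fun n hn => ?_⟩
    · rcases lt_or_ge n m with h | h
      · simpa [h.le, Nat.succ_le_of_lt h] using h1 n
      · have e1 : (if n ≤ m then γ n else P M + φ n • w) = P M + φ n • w := by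
          split_ifs with h'
          · rw [le_antisymm h' h, hφ0, h2 M le_rfl]; simp
          · rfl
        have e2 : ¬ n + 1 ≤ m := by omega
        simp only [e1, e2, if_false]
        have : P M + φ (n + 1) • w - (P M + φ n • w) = (φ (n + 1) - φ n) • w := by module
        rw [this, norm_smul, Real.norm_eq_abs]
        calc _ ≤ 1 / c M * (ε * c M) := mul_le_mul (hφs n) hwn (norm_nonneg _) (by positivity)
          _ = ε := by field_simp
    · rcases Nat.le_succ_iff.1 ht with h | rfl
      · have : ∑ u ∈ Finset.range t, c u ≤ m :=
          Finset.sum_le_sum_of_subset (Finset.range_mono h)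
        simp only [this, if_true]
        exact h2 t h
      · rw [Finset.sum_range_succ, ← hm]
        have : ¬ m + c M ≤ m := by omega
        simp only [this, if_false, hφ1 _ le_rfl, hw, Nat.succ_eq_add_one]
        module
    · rw [Finset.sum_range_succ, ← hm] at hn
      have : ¬ n ≤ m := by omega
      simp only [this, if_false, hφ1 _ hn, hw]
      module

/-! ### Efficient paths through a chain of balls -/

lemma sum_comp_le_two_mul_sum_image {ι : Type*} [DecidableEq ι] (a : ℕ → ι) (M : ℕ)
    (ha : ∀ s t, s < t → t ≤ M → a s = a t → t = s + 1) {g : ι → ℝ} (hg : ∀ i, 0 ≤ g i) :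
    ∑ t ∈ Finset.range (M + 1), g (a t)
      ≤ 2 * ∑ i ∈ (Finset.range (M + 1)).image a, g i := by
  rw [Finset.sum_comp g a, Finset.mul_sum]
  refine Finset.sum_le_sum fun i _ => ?_
  rw [nsmul_eq_mul]
  refine mul_le_mul_of_nonneg_right ?_ (hg i)
  have : ((Finset.range (M + 1)).filter fun t => a t = i).card ≤ 2 := by
    by_contra! h
    obtain ⟨u, hu, v, hv, w, hw, huv, huw, hvw⟩ := Finset.two_lt_card.1 h
    simp only [Finset.mem_filter, Finset.mem_range, Nat.lt_succ_iff] at hu hv hw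
    have key : ∀ s t, s ≤ M → t ≤ M → a s = i → a t = i → s ≠ t → t = s + 1 ∨ s = t + 1 := by
      intro s t hs ht h1 h2 hst
      rcases lt_or_gt_of_ne hst with h | h
      · exact Or.inl (ha s t h ht (h1.trans h2.symm))
      · exact Or.inr (ha t s h hs (h2.trans h1.symm))
    have k1 := key u v hu.1 hv.1 hu.2 hv.2 huv
    have k2 := key u w hu.1 hw.1 hu.2 hw.2 huw
    have k3 := key v w hv.1 hw.1 hv.2 hw.2 hvw
    omega
  exact_mod_cast this

lemma sum_edges_le_four_mul_sum_image {ι : Type*} [DecidableEq ι] (a : ℕ → ι) (M : ℕ)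
    (ha : ∀ s t, s < t → t ≤ M → a s = a t → t = s + 1) {g : ι → ℝ} (hg : ∀ i, 0 ≤ g i) :
    ∑ t ∈ Finset.range M, (g (a t) + g (a (t + 1)))
      ≤ 4 * ∑ i ∈ (Finset.range (M + 1)).image a, g i := by
  have h := sum_comp_le_two_mul_sum_image a M ha hg
  rw [Finset.sum_add_distrib]
  have h1 := Finset.sum_range_succ (fun t => g (a t)) M
  have h2 := Finset.sum_range_succ' (fun t => g (a t)) M
  have := hg (a M)
  have := hg (a 0)
  linarith

lemma exists_efficient_path {V : Type*} [NormedAddCommGroup V] [NormedSpace ℝ V]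
    {ι : Type*} [Fintype ι] {K : Set V}
    (hc : IsPreconnected K) {x : V} (hx : x ∈ K) {r : ℝ} (hr : 0 < r)
    (hout : ∃ y ∈ K, r < dist y x) {p : ι → V} {ρ : ι → ℝ}
    (hρr : ∀ e, ρ e ≤ r / 1000)
    (hcov : ∀ y ∈ K, dist y x ≤ r / 2 → ∃ e, dist y (p e) ≤ 10 * ρ e)
    (hsum : ∑ e, ρ e ≤ 7 * r) {ε : ℝ} (hε : 0 < ε) (hερ : ∀ e, ε ≤ ρ e) :
    ∃ (P : Finset ι) (τ : ι → ℕ) (T : ℕ) (γ : ℕ → V),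
      (∀ i ∈ P, dist (p i) x ≤ 3 * r / 8) ∧ (∀ n, ‖γ (n + 1) - γ n‖ ≤ ε) ∧
      (∀ i ∈ P, γ (τ i) = p i) ∧ (∀ n, T ≤ n → γ n = γ T) ∧
      (∀ i ∈ P, ∀ j ∈ P, ε * |(τ i : ℝ) - τ j| ≤ 2 ^ 13 * dist (p i) (p j) + ε) ∧
      ε * T ≤ 308 * r ∧ r / 250 ≤ ∑ i ∈ P, ρ i := by
  classical
  have hρ : ∀ e, 0 < ρ e := fun e => hε.trans_le (hερ e)
  obtain ⟨e₀, f₀, he₀, hf₀, hchain⟩ := exists_chain_of_isPreconnected hc hx hr hout hρr hcov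
  set R₁ : ι → ι → Prop := fun e f => dist (p e) (p f) ≤ 10 * (ρ e + ρ f) ∧
        dist (p e) x ≤ 3 * r / 8 ∧ dist (p f) x ≤ 3 * r / 8 with hR₁
  set R₂ : ι → ι → Prop := fun e f => dist (p e) x ≤ 3 * r / 8 ∧ dist (p f) x ≤ 3 * r / 8 with hR₂
  set far : Set ι := {f | r / 4 ≤ dist (p f) x} with hfar
  have he₀x : dist (p e₀) x ≤ r / 100 := by
    rw [dist_comm]; linarith [hρr e₀]
  have hmem : ∀ (a : ℕ → ι) (M : ℕ), a 0 = e₀ → (∀ u < M, R₂ (a u) (a (u + 1))) →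
      ∀ t ≤ M, dist (p (a t)) x ≤ 3 * r / 8 := by
    intro a M h0 hR t ht
    rcases t with _ | t
    · rw [h0]; linarith
    · exact (hR t (by omega)).2
  obtain ⟨a₁, M₁, h10, h1M, h1R, h1g, -⟩ := exists_geodesic R₁ (fun _ _ => 1) e₀ far
    ⟨f₀, hf₀, hchain⟩
  have h1R2 : ∀ u < M₁, R₂ (a₁ u) (a₁ (u + 1)) := fun u hu => (h1R u hu).2
  have h1inj : ∀ s t, s < t → t ≤ M₁ → a₁ s = a₁ t → t = s + 1 := by
    intro s t hst ht hs
    have hm := hmem a₁ M₁ h10 h1R2 t ht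
    have := h1g s t hst ht (by
      rw [hs]
      refine ⟨?_, hm, hm⟩
      rw [dist_self]; linarith [hρ (a₁ t)])
    simp at this
    omega
  have h1sum : ∑ t ∈ Finset.range M₁, (ρ (a₁ t) + ρ (a₁ (t + 1))) ≤ 28 * r := by
    have h := sum_edges_le_four_mul_sum_image a₁ M₁ h1inj (g := ρ) fun i => (hρ i).le
    have h' : ∑ i ∈ (Finset.range (M₁ + 1)).image a₁, ρ i ≤ ∑ i, ρ i :=
      Finset.sum_le_sum_of_subset_of_nonneg (Finset.subset_univ _) fun i _ _ => (hρ i).le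
    linarith
  set L : ι → ι → ℝ := fun e f => if dist (p e) (p f) ≤ 10 * (ρ e + ρ f) then
    min (2 ^ 13 * dist (p e) (p f)) (10 * (ρ e + ρ f)) else 2 ^ 13 * dist (p e) (p f) with hL
  set c : ι → ι → ℕ := fun e f => ⌊L e f / ε⌋₊ + 1 with hcdef
  have hdL : ∀ e f, dist (p e) (p f) ≤ L e f := by
    intro e f
    have := dist_nonneg (x := p e) (y := p f)
    simp only [hL]
    split_ifs with h
    · exact le_min (by linarith) h
    · linarith
  have hLd : ∀ e f, L e f ≤ 2 ^ 13 * dist (p e) (p f) := by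
    intro e f
    simp only [hL]
    split_ifs with h
    · exact min_le_left _ _
    · exact le_rfl
  have hLρ : ∀ e f, dist (p e) (p f) ≤ 10 * (ρ e + ρ f) → L e f ≤ 10 * (ρ e + ρ f) := by
    intro e f h
    simp only [hL, h, if_true]
    exact min_le_right _ _
  have hL0 : ∀ e f, 0 ≤ L e f := fun e f => dist_nonneg.trans (hdL e f)
  have hcL : ∀ e f, L e f ≤ ε * c e f := by
    intro e f
    have := (Nat.lt_floor_add_one (L e f / ε)).le
    rw [div_le_iff₀ hε] at this
    simp only [hcdef]; push_cast; linarith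
  have hcL' : ∀ e f, ε * c e f ≤ L e f + ε := by
    intro e f
    have := Nat.floor_le (div_nonneg (hL0 e f) hε.le)
    rw [le_div_iff₀ hε] at this
    simp only [hcdef]; push_cast; linarith
  have hdc : ∀ e f, dist (p e) (p f) ≤ 10 * (ρ e + ρ f) + ε * c e f / 2 ^ 13 := by
    intro e f
    have h1 := hcL e f
    have h2 := hL0 e f
    by_cases h : dist (p e) (p f) ≤ 10 * (ρ e + ρ f)
    · have : 0 ≤ ε * c e f / 2 ^ 13 := by positivity
      linarith
    · have h3 : L e f = 2 ^ 13 * dist (p e) (p f) := by simp only [hL, h, if_false]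
      have := hρ e
      have := hρ f
      rw [h3] at h1
      have : dist (p e) (p f) ≤ ε * c e f / 2 ^ 13 := by
        rw [le_div_iff₀ (by positivity)]; linarith
      linarith
  obtain ⟨a, M, h0, hM, hR, hg, hmin⟩ := exists_geodesic R₂ c e₀ far
    ⟨f₀, hf₀, (Relation.ReflTransGen.mono (r := R₁) (p := R₂) fun _ _ h => h.2) _ _ hchain⟩
  have hmin' := hmin a₁ M₁ h10 h1M h1R2
  have hain := hmem a M h0 hR
  have hg' : ∀ s t, s < t → t ≤ M → ∑ u ∈ Finset.range t, c (a u) (a (u + 1))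
          ≤ ∑ u ∈ Finset.range s, c (a u) (a (u + 1)) + c (a s) (a t) := fun s t hst ht =>
    hg s t hst ht ⟨hain s (by omega), hain t ht⟩
  have hT : ε * ((∑ u ∈ Finset.range M, c (a u) (a (u + 1)) : ℕ) : ℝ) ≤ 308 * r := by
    have h1 : ((∑ u ∈ Finset.range M, c (a u) (a (u + 1)) : ℕ) : ℝ)
        ≤ ((∑ u ∈ Finset.range M₁, c (a₁ u) (a₁ (u + 1)) : ℕ) : ℝ) := by exact_mod_cast hmin'
    have h2 : ε * ((∑ u ∈ Finset.range M₁, c (a₁ u) (a₁ (u + 1)) : ℕ) : ℝ)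
        ≤ ∑ u ∈ Finset.range M₁, 11 * (ρ (a₁ u) + ρ (a₁ (u + 1))) := by
      push_cast
      rw [Finset.mul_sum]
      refine Finset.sum_le_sum fun u hu => ?_
      have := hLρ _ _ (h1R u (Finset.mem_range.1 hu)).1
      have := hcL' (a₁ u) (a₁ (u + 1))
      linarith [hερ (a₁ u), hρ (a₁ (u + 1))]
    rw [← Finset.mul_sum] at h2
    have := mul_le_mul_of_nonneg_left h1 hε.le
    linarith
  have hinj : ∀ s t, s < t → t ≤ M → a s = a t → t = s + 1 := by
    intro s t hst ht hs
    have h1 := hg' s t hst ht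
    have h2 : c (a s) (a t) = 1 := by
      have : L (a s) (a t) = 0 := by
        have := hLd (a s) (a t)
        rw [hs, dist_self] at this
        have h' := hL0 (a s) (a t)
        rw [hs] at h' ⊢
        linarith
      simp [hcdef, this]
    obtain ⟨d, rfl⟩ : ∃ d, t = s + 1 + d := Nat.exists_eq_add_of_le hst
    rw [h2, Finset.sum_range_add, Finset.sum_range_succ] at h1
    have h3 : d ≤ ∑ u ∈ Finset.range d, c (a (s + 1 + u)) (a (s + 1 + u + 1)) := by
      have := Finset.card_nsmul_le_sum (Finset.range d)
        (fun u => c (a (s + 1 + u)) (a (s + 1 + u + 1))) 1 fun u _ => by simp [hcdef]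
      simpa using this
    have h4 : 1 ≤ c (a s) (a (s + 1)) := by simp [hcdef]
    omega
  have hmass : r / 250 ≤ ∑ i ∈ (Finset.range (M + 1)).image a, ρ i := by
    have h1 := sum_edges_le_four_mul_sum_image a M hinj (g := ρ) fun i => (hρ i).le
    have h2 : dist (p (a 0)) (p (a M)) ≤ ∑ u ∈ Finset.range M, dist (p (a u)) (p (a (u + 1))) :=
      dist_le_range_sum_dist (fun u => p (a u)) M
    have h3 : ∑ u ∈ Finset.range M, dist (p (a u)) (p (a (u + 1)))
        ≤ ∑ u ∈ Finset.range M, (10 * (ρ (a u) + ρ (a (u + 1)))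
          + ε * c (a u) (a (u + 1)) / 2 ^ 13) := Finset.sum_le_sum fun u _ => hdc _ _
    rw [Finset.sum_add_distrib, ← Finset.mul_sum, ← Finset.sum_div, ← Finset.mul_sum] at h3
    push_cast at hT
    have h4 : r / 4 ≤ dist (p (a M)) x := hM
    have h5 := dist_triangle_left (p (a M)) x (p (a 0))
    rw [h0] at h5 h2
    linarith
  obtain ⟨γ, hγ1, hγ2, hγ3⟩ := exists_interpolating_sequence (fun t => p (a t))
    (fun u => c (a u) (a (u + 1))) hε.le M fun u _ => (hdL _ _).trans (hcL _ _)
  have hex : ∀ i, ∃ t, i ∈ (Finset.range (M + 1)).image a → t ≤ M ∧ a t = i := by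
    intro i
    by_cases hi : i ∈ (Finset.range (M + 1)).image a
    · obtain ⟨t, ht, rfl⟩ := Finset.mem_image.1 hi
      exact ⟨t, fun _ => ⟨by simpa [Nat.lt_succ_iff] using ht, rfl⟩⟩
    · exact ⟨0, fun h => absurd h hi⟩
  choose θ hθ using hex
  refine ⟨(Finset.range (M + 1)).image a, fun i => ∑ u ∈ Finset.range (θ i), c (a u) (a (u + 1)),
    ∑ u ∈ Finset.range M, c (a u) (a (u + 1)), γ, fun i hi => ?_, hγ1, fun i hi => ?_,
    fun n hn => ?_, ?_, hT, hmass⟩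
  · rw [← (hθ i hi).2]; exact hain _ (hθ i hi).1
  · rw [hγ2 _ (hθ i hi).1, (hθ i hi).2]
  · rw [hγ3 n hn, hγ3 _ le_rfl]
  · have key : ∀ s t, s < t → t ≤ M →
        ε * |((∑ u ∈ Finset.range t, c (a u) (a (u + 1)) : ℕ) : ℝ)
          - ((∑ u ∈ Finset.range s, c (a u) (a (u + 1)) : ℕ) : ℝ)|
          ≤ 2 ^ 13 * dist (p (a s)) (p (a t)) + ε := by
      intro s t hst ht
      have h1 : ((∑ u ∈ Finset.range t, c (a u) (a (u + 1)) : ℕ) : ℝ)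
          ≤ ((∑ u ∈ Finset.range s, c (a u) (a (u + 1)) : ℕ) : ℝ) + (c (a s) (a t) : ℕ) := by
        exact_mod_cast hg' s t hst ht
      have h2 : ((∑ u ∈ Finset.range s, c (a u) (a (u + 1)) : ℕ) : ℝ)
          ≤ ((∑ u ∈ Finset.range t, c (a u) (a (u + 1)) : ℕ) : ℝ) := by
        exact_mod_cast Finset.sum_le_sum_of_subset (Finset.range_mono hst.le)
      rw [abs_of_nonneg (by linarith)]
      have h3 := hcL' (a s) (a t)
      have h4 := hLd (a s) (a t)
      have := mul_le_mul_of_nonneg_left h1 hε.le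
      linarith
    intro i hi j hj
    simp only
    obtain ⟨hi1, hi2⟩ := hθ i hi
    obtain ⟨hj1, hj2⟩ := hθ j hj
    rcases lt_trichotomy (θ i) (θ j) with h | h | h
    · have := key _ _ h hj1
      rwa [hi2, hj2, abs_sub_comm] at this
    · rw [h, sub_self, abs_zero, mul_zero]; positivity
    · have := key _ _ h hi1
      rwa [hi2, hj2, dist_comm] at this

/-! ### Counting curved and flat scales along a path -/

section Counting

variable {V : Type*} [NormedAddCommGroup V] [InnerProductSpace ℝ V]

lemma exists_line_near_window [Nontrivial V] (γ : ℕ → V) (M a : ℕ) :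
    ∃ ℓ : Set V, IsLine ℓ ∧ ∀ u ≤ 2 ^ M, infDist (γ (a + u)) ℓ ≤ devBound γ M a := by
  by_cases h : γ (a + 2 ^ M) - γ a = 0
  · obtain ⟨v, hv⟩ := exists_ne (0 : V)
    refine ⟨{p | ∃ t : ℝ, p = γ a + t • v}, ⟨γ a, v, hv, rfl⟩, fun u hu => ?_⟩
    have hmem : γ a ∈ {p | ∃ t : ℝ, p = γ a + t • v} := ⟨0, by simp⟩
    refine (infDist_le_dist_of_mem hmem).trans ?_
    simpa [h, dist_eq_norm] using norm_sub_interpolation_le_devBound γ M a u hu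
  · refine ⟨{p | ∃ t : ℝ, p = γ a + t • (γ (a + 2 ^ M) - γ a)}, ⟨γ a, _, h, rfl⟩,
      fun u hu => ?_⟩
    have hmem : γ a + ((u : ℝ) / 2 ^ M) • (γ (a + 2 ^ M) - γ a)
      ∈ {p | ∃ t : ℝ, p = γ a + t • (γ (a + 2 ^ M) - γ a)} := ⟨_, rfl⟩
    refine (infDist_le_dist_of_mem hmem).trans ?_
    rw [dist_eq_norm]
    exact norm_sub_interpolation_le_devBound γ M a u hu

lemma sum_sq_devBound_shift_le {γ : ℕ → V} {ε : ℝ} (hγ : ∀ n, ‖γ (n + 1) - γ n‖ ≤ ε) {T : ℕ}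
    (hT : ∀ n, T ≤ n → γ n = γ T) (O Q : ℕ) :
    ∑ M ∈ Finset.range Q,
      (∑ a ∈ Finset.range (O + T), devBound (fun n => γ (n - O)) M a ^ 2) / 4 ^ M
      ≤ 3 * (T * ε ^ 2) := by
  refine (sum_sq_devBound_le (γ := fun n => γ (n - O)) (N := O + T) (fun n hn => ?_) Q).trans ?_
  · simp only [Nat.add_sub_cancel_left]
    exact hT _ (by omega)
  · refine mul_le_mul_of_nonneg_left ?_ (by norm_num)
    rw [Finset.sum_range_add]
    have h1 : ∑ a ∈ Finset.range O, ‖γ (a + 1 - O) - γ (a - O)‖ ^ 2 = 0 :=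
      Finset.sum_eq_zero fun a ha => by
        have := Finset.mem_range.1 ha
        rw [Nat.sub_eq_zero_of_le this.le, Nat.sub_eq_zero_of_le (Nat.succ_le_of_lt this)]
        simp
    have h2 : ∑ a ∈ Finset.range T, ‖γ (O + a + 1 - O) - γ (O + a - O)‖ ^ 2
        ≤ ∑ a ∈ Finset.range T, ε ^ 2 := Finset.sum_le_sum fun a _ => by
      rw [add_assoc, Nat.add_sub_cancel_left, Nat.add_sub_cancel_left]
      exact pow_le_pow_left₀ (norm_nonneg _) (hγ a) 2
    rw [Finset.sum_const, Finset.card_range, nsmul_eq_mul] at h2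
    linarith

lemma sum_radii_mul_sq_le_sum_devBound {ι : Type*} (S : Finset ι) {γ : ℕ → V} {N : ℕ}
    (hN : ∀ n, N ≤ n → γ n = γ N) (M h : ℕ) {ρ : ι → ℝ} {s : ι → ℕ} (hρ : ∀ i ∈ S, 0 < ρ i)
    (hs : ∀ i ∈ S, h ≤ s i)
    (hsep : ∀ i ∈ S, ∀ j ∈ S, i ≠ j → ρ i + ρ j ≤ |(s i : ℝ) - s j|) {δ : ℝ} (hδ : 0 ≤ δ)
    (hS : ∀ i ∈ S, ∀ a : ℕ, s i ≤ a + h → ((a + h : ℕ) : ℝ) < s i + ρ i →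
      δ < devBound γ M a) :
    ∑ i ∈ S, ρ i * δ ^ 2 ≤ ∑ a ∈ Finset.range N, devBound γ M a ^ 2 := by
  classical
  set I : ι → Finset ℕ := fun i => Finset.Ico (s i - h) (s i - h + ⌈ρ i⌉₊) with hI
  have hmem : ∀ i ∈ S, ∀ a ∈ I i, s i ≤ a + h ∧ ((a + h : ℕ) : ℝ) < s i + ρ i := by
    intro i hi a ha
    obtain ⟨h1, h2⟩ := Finset.mem_Ico.1 ha
    have h0 := hs i hi
    have h3 : s i ≤ a + h := by omega
    have h4 : a + h - s i < ⌈ρ i⌉₊ := by omega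
    have h5 := Nat.lt_ceil.1 h4
    rw [Nat.cast_sub h3] at h5
    exact ⟨h3, by linarith⟩
  have hdis : (S : Set ι).PairwiseDisjoint I := by
    intro i hi j hj hij
    refine Finset.disjoint_left.2 fun a hai haj => ?_
    obtain ⟨h1, h2⟩ := hmem i hi a hai
    obtain ⟨h3, h4⟩ := hmem j hj a haj
    have h1' : (s i : ℝ) ≤ ((a + h : ℕ) : ℝ) := by exact_mod_cast h1
    have h3' : (s j : ℝ) ≤ ((a + h : ℕ) : ℝ) := by exact_mod_cast h3
    have h5 := hsep i hi j hj hij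
    have h7 : |(s i : ℝ) - s j| < ρ i + ρ j := by
      have := hρ i hi
      have := hρ j hj
      rw [abs_lt]
      constructor <;> linarith
    linarith
  have hsub : S.biUnion I ⊆ Finset.range N := by
    intro a ha
    obtain ⟨i, hi, hai⟩ := Finset.mem_biUnion.1 ha
    obtain ⟨h1, h2⟩ := hmem i hi a hai
    have h3 := hS i hi a h1 h2
    rw [Finset.mem_range]
    by_contra hcon
    rw [devBound_eq_zero hN _ _ (not_lt.1 hcon)] at h3
    linarith
  calc ∑ i ∈ S, ρ i * δ ^ 2
      ≤ ∑ i ∈ S, ∑ a ∈ I i, devBound γ M a ^ 2 := by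
        refine Finset.sum_le_sum fun i hi => ?_
        have hc : ∑ a ∈ I i, δ ^ 2 ≤ ∑ a ∈ I i, devBound γ M a ^ 2 :=
          Finset.sum_le_sum fun a ha => by
            obtain ⟨h1, h2⟩ := hmem i hi a ha
            exact pow_le_pow_left₀ hδ (hS i hi a h1 h2).le 2
        refine le_trans ?_ hc
        rw [Finset.sum_const, nsmul_eq_mul, Nat.card_Ico, Nat.add_sub_cancel_left]
        exact mul_le_mul_of_nonneg_right (Nat.le_ceil _) (by positivity)
    _ = ∑ a ∈ S.biUnion I, devBound γ M a ^ 2 := (Finset.sum_biUnion hdis).symm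
    _ ≤ _ := Finset.sum_le_sum_of_subset_of_nonneg hsub fun a _ _ => by positivity

lemma sum_radii_mul_card_curved_le {ι : Type*} (S : Finset ι) {γ : ℕ → V} {q T : ℕ}
    (hγ : ∀ n, ‖γ (n + 1) - γ n‖ ≤ (1 / 2) ^ q) (hT : ∀ n, T ≤ n → γ n = γ T)
    {ρ : ι → ℝ} {τ : ι → ℕ} (hρ : ∀ i ∈ S, 0 < ρ i)
    (hsep : ∀ i ∈ S, ∀ j ∈ S, i ≠ j → ρ i + ρ j ≤ (1 / 2) ^ q * |(τ i : ℝ) - τ j|)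
    {η : ℝ} (hη : 0 ≤ η) (A : ι → Finset ℕ) (hAq : ∀ i ∈ S, ∀ k ∈ A i, k ≤ q)
    (hA : ∀ i ∈ S, ∀ k ∈ A i, ∀ a : ℕ, (2 : ℝ) ^ (q + 16) + τ i ≤ a + 2 ^ (q - k + 15) →
      (a : ℝ) + 2 ^ (q - k + 15) < 2 ^ (q + 16) + τ i + 2 ^ q * ρ i →
      η * (1 / 2) ^ k < devBound (fun n => γ (n - 2 ^ (q + 16))) (q - k + 16) a) :
    η ^ 2 * ∑ i ∈ S, ρ i * (A i).card ≤ 3 * 4 ^ 16 * ((1 / 2) ^ q * T) := by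
  classical
  obtain ⟨O, hO⟩ : ∃ O : ℕ, O = 2 ^ (q + 16) := ⟨_, rfl⟩
  rw [← hO] at hA
  set γ' : ℕ → V := fun n => γ (n - O) with hγ'
  set X : ℕ → ℝ := fun M => ∑ a ∈ Finset.range (O + T), devBound γ' M a ^ 2 with hX
  have hX0 : ∀ M, 0 ≤ X M := fun M => by simp only [hX]; positivity
  have hconst : ∀ n, O + T ≤ n → γ' n = γ' (O + T) := fun n hn => by
    simp only [hγ', Nat.add_sub_cancel_left]
    exact hT _ (by omega)
  have h2q : (2 : ℝ) ^ q * (1 / 2) ^ q = 1 := by rw [← mul_pow]; norm_num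
  have h2q0 : (0 : ℝ) < 2 ^ q := by positivity
  have hk : ∀ k ≤ q, η ^ 2 * ∑ i ∈ S with k ∈ A i, ρ i
      ≤ (1 / 2) ^ q * 4 ^ (q + 16) * (X (q - k + 16) / 4 ^ (q - k + 16)) := by
    intro k hkq
    have hle : 2 ^ (q - k + 15) ≤ O := by
      rw [hO]
      exact Nat.pow_le_pow_right (by norm_num) (by omega)
    have h1 : ∑ i ∈ S with k ∈ A i, 2 ^ q * ρ i * (η * (1 / 2) ^ k) ^ 2 ≤ X (q - k + 16) := by
      refine sum_radii_mul_sq_le_sum_devBound _ hconst _ (2 ^ (q - k + 15))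
        (s := fun i => O + τ i) (fun i hi => mul_pos h2q0 (hρ i (Finset.mem_filter.1 hi).1))
        (fun i _ => hle.trans (Nat.le_add_right _ _)) (fun i hi j hj hij => ?_) (by positivity)
        fun i hi a h1 h2 => ?_
      · have h5 := mul_le_mul_of_nonneg_left (hsep i (Finset.mem_filter.1 hi).1 j
          (Finset.mem_filter.1 hj).1 hij) h2q0.le
        rw [← mul_assoc, h2q, one_mul] at h5
        push_cast
        rwa [add_sub_add_left_eq_sub, ← mul_add]
      · obtain ⟨hiS, hki⟩ := Finset.mem_filter.1 hi
        have h3 : ((O + τ i : ℕ) : ℝ) ≤ ((a + 2 ^ (q - k + 15) : ℕ) : ℝ) := by exact_mod_cast h1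
        push_cast [hO] at h2 h3
        exact hA i hiS k hki a h3 h2
    have e1 : ∑ i ∈ S with k ∈ A i, 2 ^ q * ρ i * (η * (1 / 2) ^ k) ^ 2
        = 2 ^ q * (1 / 4) ^ k * (η ^ 2 * ∑ i ∈ S with k ∈ A i, ρ i) := by
      rw [Finset.mul_sum, Finset.mul_sum]
      refine Finset.sum_congr rfl fun i _ => ?_
      rw [mul_pow, ← pow_mul, mul_comm k 2, pow_mul]
      norm_num
      ring
    rw [e1] at h1
    have e2 : (1 / 2 : ℝ) ^ q * 4 ^ (q + 16) * (X (q - k + 16) / 4 ^ (q - k + 16))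
        = (1 / 2) ^ q * 4 ^ k * X (q - k + 16) := by
      obtain ⟨l, rfl⟩ := Nat.exists_eq_add_of_le hkq
      rw [Nat.add_sub_cancel_left]
      have : (4 : ℝ) ^ (k + l + 16) = 4 ^ k * 4 ^ (l + 16) := by ring
      rw [this]
      field_simp
    rw [e2]
    have h4 : (4 : ℝ) ^ k * (1 / 4) ^ k = 1 := by rw [← mul_pow]; norm_num
    calc η ^ 2 * ∑ i ∈ S with k ∈ A i, ρ i
        = (1 / 2) ^ q * 4 ^ k * (2 ^ q * (1 / 4) ^ k * (η ^ 2 * ∑ i ∈ S with k ∈ A i, ρ i)) := by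
          have : (1 / 2 : ℝ) ^ q * 4 ^ k * (2 ^ q * (1 / 4) ^ k)
            = (2 ^ q * (1 / 2) ^ q) * (4 ^ k * (1 / 4) ^ k) := by ring
          rw [← mul_assoc, this, h2q, h4]; ring
      _ ≤ _ := mul_le_mul_of_nonneg_left h1 (by positivity)
  have e3 : ∑ i ∈ S, ρ i * (A i).card
      = ∑ k ∈ Finset.range (q + 1), ∑ i ∈ S with k ∈ A i, ρ i := by
    have : ∀ i ∈ S, ρ i * (A i).card = ∑ k ∈ Finset.range (q + 1), if k ∈ A i then ρ i else 0 := by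
      intro i hi
      rw [← Finset.sum_filter, Finset.sum_const, nsmul_eq_mul, mul_comm]
      congr 3
      ext k
      simp only [Finset.mem_filter, Finset.mem_range]
      exact ⟨fun h => ⟨Nat.lt_succ_of_le (hAq i hi k h), h⟩, fun h => h.2⟩
    rw [Finset.sum_congr rfl this, Finset.sum_comm]
    simp only [Finset.sum_filter]
  have h5 : ∑ k ∈ Finset.range (q + 1), X (q - k + 16) / 4 ^ (q - k + 16)
      ≤ 3 * (T * ((1 / 2) ^ q) ^ 2) := by
    have h6 := Finset.sum_range_reflect (fun j => X (j + 16) / 4 ^ (j + 16)) (q + 1)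
    simp only [Nat.add_sub_cancel] at h6
    rw [h6]
    refine le_trans ?_ (sum_sq_devBound_shift_le hγ hT O (16 + (q + 1)))
    have h7 := Finset.sum_range_add (fun M => X M / 4 ^ M) 16 (q + 1)
    simp only [add_comm 16 (_ : ℕ)] at h7
    have : 0 ≤ ∑ M ∈ Finset.range 16, X M / 4 ^ M := Finset.sum_nonneg fun M _ =>
      div_nonneg (hX0 M) (by positivity)
    rw [add_comm 16 (q + 1)]
    exact (le_add_of_nonneg_left this).trans h7.ge
  calc η ^ 2 * ∑ i ∈ S, ρ i * (A i).card
      = ∑ k ∈ Finset.range (q + 1), η ^ 2 * ∑ i ∈ S with k ∈ A i, ρ i := by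
        rw [e3, Finset.mul_sum]
    _ ≤ ∑ k ∈ Finset.range (q + 1),
          (1 / 2) ^ q * 4 ^ (q + 16) * (X (q - k + 16) / 4 ^ (q - k + 16)) :=
        Finset.sum_le_sum fun k hkk => hk k (Nat.lt_succ_iff.1 (Finset.mem_range.1 hkk))
    _ ≤ (1 / 2) ^ q * 4 ^ (q + 16) * (3 * (T * ((1 / 2) ^ q) ^ 2)) := by
        rw [← Finset.mul_sum]
        exact mul_le_mul_of_nonneg_left h5 (by positivity)
    _ = 3 * 4 ^ 16 * ((1 / 2) ^ q * T) := by
        have : (4 : ℝ) ^ q * ((1 / 2) ^ q) ^ 2 = 1 := by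
          rw [← pow_mul, mul_comm q 2, pow_mul, ← mul_pow]; norm_num
        calc (1 / 2) ^ q * 4 ^ (q + 16) * (3 * (T * ((1 / 2) ^ q) ^ 2))
            = 3 * 4 ^ 16 * ((1 / 2) ^ q * (T : ℝ)) * (4 ^ q * ((1 / 2) ^ q) ^ 2) := by
              rw [pow_add (4 : ℝ)]
              generalize (1 / 2 : ℝ) ^ q = y
              ring
          _ = _ := by rw [this, mul_one]

end Counting

lemma card_le_of_forall_pow_le (s : Finset ℕ) {Λ : ℝ} (hΛ : 0 ≤ Λ)
    (h : ∀ k ∈ s, ∀ k' ∈ s, (1 / 2 : ℝ) ^ k' ≤ Λ * (1 / 2) ^ k) : (s.card : ℝ) ≤ Λ := by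
  rcases s.eq_empty_or_nonempty with rfl | hs
  · simpa using hΛ
  have hsub : s ⊆ Finset.Icc (s.min' hs) (s.max' hs) := fun k hk =>
    Finset.mem_Icc.2 ⟨s.min'_le k hk, s.le_max' k hk⟩
  have h1 := Finset.card_le_card hsub
  rw [Nat.card_Icc] at h1
  have h2 := h _ (s.max'_mem hs) _ (s.min'_mem hs)
  obtain ⟨d, hd⟩ := Nat.exists_eq_add_of_le (s.min'_le _ (s.max'_mem hs))
  rw [hd, pow_add] at h2
  have h3 : (0 : ℝ) < (1 / 2) ^ s.min' hs := by positivity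
  have h4 : (1 : ℝ) ≤ Λ * (1 / 2) ^ d := by
    by_contra! hcon
    nlinarith
  have h5 : (2 : ℝ) ^ d ≤ Λ := by
    have e : (1 / 2 : ℝ) ^ d * 2 ^ d = 1 := by rw [← mul_pow]; norm_num
    have := mul_le_mul_of_nonneg_right h4 (show (0 : ℝ) ≤ 2 ^ d by positivity)
    rwa [one_mul, mul_assoc, e, mul_one] at this
  have h6 : d + 1 ≤ 2 ^ d := Nat.lt_two_pow_self
  have h7 : ((d + 1 : ℕ) : ℝ) ≤ 2 ^ d := by exact_mod_cast h6
  have h8 : (s.card : ℝ) ≤ ((d + 1 : ℕ) : ℝ) := by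
    have : s.card ≤ d + 1 := by omega
    exact_mod_cast this
  linarith

lemma sum_radii_mul_card_flat_le {V : Type*} [MetricSpace V] {ι : Type*} [Fintype ι]
    (S : Finset ι) {p : ι → V} {ρ : ι → ℝ} {τ : ι → ℕ} {ε : ℝ} (hε : 0 ≤ ε)
    (hερ : ∀ i, ε ≤ ρ i)
    (hsep : ∀ i ∈ S, ∀ j ∈ S, i ≠ j → ρ i + ρ j ≤ ε * |(τ i : ℝ) - τ j|)
    (hτ : ∀ i ∈ S, ∀ j ∈ S, ε * |(τ i : ℝ) - τ j| ≤ 2 ^ 13 * dist (p i) (p j) + ε)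
    {b : ℝ} (hb : 0 < b) (A : ι → Finset ℕ) (F : ι → ℕ → Finset ι)
    (hA : ∀ i ∈ S, ∀ k ∈ A i, ρ i ≤ (1 / 2) ^ k)
    (hF : ∀ i ∈ S, ∀ k ∈ A i, b * (1 / 2) ^ k ≤ ∑ e ∈ F i k, 80 * ρ e)
    (hF1 : ∀ i ∈ S, ∀ k ∈ A i, ∀ e ∈ F i k, ρ e ≤ (1 / 2) ^ k ∧ dist (p i) (p e) ≤ 13 * (1 / 2) ^ k)
    (hF2 : ∀ i ∈ S, ∀ k ∈ A i, ∀ e ∈ F i k, ∀ j ∈ S,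
      b * (1 / 2) ^ k / 4 ≤ dist (p j) (p e) + 10 * ρ e) :
    b ^ 2 * ∑ i ∈ S, ρ i * (A i).card ≤ 92 * 80 * 28 * 2 ^ 13 * ∑ e, ρ e := by
  classical
  have hρ : ∀ i, 0 ≤ ρ i := fun i => hε.trans (hερ i)
  set Ks : ι → Finset ℕ := fun e =>
    (S.biUnion A).filter fun k => ∃ i ∈ S, k ∈ A i ∧ e ∈ F i k with hKs
  have hcard : ∀ e, ((Ks e).card : ℝ) ≤ 92 / b := by
    intro e
    refine card_le_of_forall_pow_le _ (by positivity) fun k hk k' hk' => ?_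
    obtain ⟨i, hi, hki, hei⟩ := (Finset.mem_filter.1 hk).2
    obtain ⟨i', hi', hki', hei'⟩ := (Finset.mem_filter.1 hk').2
    have h1 := hF1 i hi k hki e hei
    have h2 := hF2 i' hi' k' hki' e hei' i hi
    rw [div_mul_eq_mul_div, le_div_iff₀ hb]
    linarith
  have hpack : ∀ e k, ∑ i ∈ S with k ∈ A i ∧ e ∈ F i k, ρ i ≤ 28 * 2 ^ 13 * (1 / 2) ^ k := by
    intro e k
    have hk0 : (0 : ℝ) < (1 / 2) ^ k := by positivity
    refine (sum_le_of_pairwise_add_le_abs (X := 27 * 2 ^ 13 * (1 / 2) ^ k) (D := (1 / 2) ^ k)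
      (t := fun i => ε * (τ i : ℝ)) _ (fun i _ => hρ i) (fun i hi => ?_) (fun i hi j hj hij => ?_)
      (fun i hi j hj => ?_) (by positivity)).trans ?_
    · obtain ⟨hi, hki, -⟩ := Finset.mem_filter.1 hi
      exact hA i hi k hki
    · rw [← mul_sub, abs_mul, abs_of_nonneg hε]
      exact hsep i (Finset.mem_filter.1 hi).1 j (Finset.mem_filter.1 hj).1 hij
    · obtain ⟨hi, hki, hei⟩ := Finset.mem_filter.1 hi
      obtain ⟨hj, hkj, hej⟩ := Finset.mem_filter.1 hj
      rw [← mul_sub, abs_mul, abs_of_nonneg hε]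
      have h1 := hτ i hi j hj
      have h2 := (hF1 i hi k hki e hei).2
      have h3 := (hF1 j hj k hkj e hej).2
      have h4 := dist_triangle_right (p i) (p j) (p e)
      have h5 := hA i hi k hki
      have := hερ i
      linarith
    · linarith
  have h1 : ∀ i ∈ S, ρ i * (A i).card
      ≤ ∑ e, ∑ k ∈ Ks e, (if k ∈ A i ∧ e ∈ F i k then ρ i else 0)
        * (80 * ρ e / (b * (1 / 2) ^ k)) := by
    intro i hi
    have h2 : ∀ k ∈ A i, ρ i ≤ ∑ e, (if e ∈ F i k then ρ i else 0)
        * (80 * ρ e / (b * (1 / 2) ^ k)) := by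
      intro k hk
      have hbk : 0 < b * (1 / 2 : ℝ) ^ k := by positivity
      have h3 : ∑ e, (if e ∈ F i k then ρ i else 0) * (80 * ρ e / (b * (1 / 2) ^ k))
          = ρ i * ((∑ e ∈ F i k, 80 * ρ e) / (b * (1 / 2) ^ k)) := by
        simp only [ite_mul, zero_mul]
        rw [Finset.sum_ite_mem, Finset.univ_inter, ← Finset.mul_sum, Finset.sum_div]
      rw [h3]
      refine le_mul_of_one_le_right (hρ i) ?_
      rw [one_le_div hbk]
      exact hF i hi k hk
    have h4 : ρ i * (A i).card ≤ ∑ k ∈ A i, ∑ e,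
        (if e ∈ F i k then ρ i else 0) * (80 * ρ e / (b * (1 / 2) ^ k)) := by
      have := Finset.sum_le_sum h2
      rwa [Finset.sum_const, nsmul_eq_mul, mul_comm] at this
    refine h4.trans ?_
    rw [Finset.sum_comm]
    refine Finset.sum_le_sum fun e _ => ?_
    have h5 : ∑ k ∈ A i, (if e ∈ F i k then ρ i else 0) * (80 * ρ e / (b * (1 / 2) ^ k))
        = ∑ k ∈ A i with e ∈ F i k,
          (if k ∈ A i ∧ e ∈ F i k then ρ i else 0) * (80 * ρ e / (b * (1 / 2) ^ k)) := by
      rw [Finset.sum_filter]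
      refine Finset.sum_congr rfl fun k hk => ?_
      by_cases h : e ∈ F i k <;> simp [h, hk]
    rw [h5]
    refine Finset.sum_le_sum_of_subset_of_nonneg (fun k hk => ?_) fun k _ _ => ?_
    · obtain ⟨hk, he⟩ := Finset.mem_filter.1 hk
      exact Finset.mem_filter.2 ⟨Finset.mem_biUnion.2 ⟨i, hi, hk⟩, i, hi, hk, he⟩
    · have := hρ i
      have := hρ e
      split_ifs <;> positivity
  have h2 : ∑ i ∈ S, ρ i * (A i).card ≤ ∑ e, 92 / b * (80 * 28 * 2 ^ 13 / b * ρ e) := by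
    refine (Finset.sum_le_sum h1).trans ?_
    rw [Finset.sum_comm]
    refine Finset.sum_le_sum fun e _ => ?_
    rw [Finset.sum_comm]
    have h3 : ∀ k ∈ Ks e, ∑ i ∈ S,
        (if k ∈ A i ∧ e ∈ F i k then ρ i else 0) * (80 * ρ e / (b * (1 / 2) ^ k))
        ≤ 80 * 28 * 2 ^ 13 / b * ρ e := by
      intro k _
      rw [← Finset.sum_mul, ← Finset.sum_filter]
      have hk0 : (0 : ℝ) < (1 / 2) ^ k := by positivity
      have := hρ e
      refine (mul_le_mul_of_nonneg_right (hpack e k) (by positivity)).trans (le_of_eq ?_)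
      field_simp
    refine (Finset.sum_le_sum h3).trans ?_
    rw [Finset.sum_const, nsmul_eq_mul]
    have := hρ e
    exact mul_le_mul_of_nonneg_right (hcard e) (by positivity)
  calc b ^ 2 * ∑ i ∈ S, ρ i * (A i).card
      ≤ b ^ 2 * ∑ e, 92 / b * (80 * 28 * 2 ^ 13 / b * ρ e) :=
        mul_le_mul_of_nonneg_left h2 (by positivity)
    _ = _ := by
        rw [← Finset.mul_sum, ← Finset.mul_sum]
        field_simp

/-! ### The block estimate -/

lemma exists_cover_of_flat {V : Type*} [MetricSpace V] {K : Set V} (hc : IsPreconnected K)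
    {x : V} {r : ℝ} (hout : ∃ y ∈ K, r < dist y x) {ι : Type*} [Fintype ι] {p : ι → V} {ρ : ι → ℝ}
    (hρ : ∀ e, 0 < ρ e) (hcov : ∀ y ∈ K, dist y x ≤ r / 2 → ∃ e, dist y (p e) ≤ 10 * ρ e)
    {c : V} (hcx : dist c x ≤ 3 * r / 8) {s b : ℝ} (hs : 0 < s) (hsr : s ≤ r / 128) (hb : 0 < b)
    (hb1 : b < 1) (hsafe : ∀ e, dist c (p e) ≤ 3 * s + 10 * ρ e → ρ e ≤ s) {ℓ : Set V}
    {z : V} (hzK : z ∈ K) (hzc : dist z c ≤ 2 * s) (hzℓ : b * s ≤ infDist z ℓ) {S : Finset ι}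
    (hS : ∀ j ∈ S, dist (p j) c ≤ 5 / 2 * s → infDist (p j) ℓ ≤ b / 4 * s) :
    ∃ F : Finset ι, b * s ≤ ∑ e ∈ F, 80 * ρ e ∧ (∀ e ∈ F, ρ e ≤ s ∧ dist c (p e) ≤ 13 * s) ∧
      ∀ e ∈ F, ∀ j ∈ S, b * s / 4 ≤ dist (p j) (p e) + 10 * ρ e := by
  classical
  have hbs : 0 < b * s := by positivity
  have hbs1 : b * s ≤ s := by nlinarith
  refine ⟨Finset.univ.filter fun e => dist z (p e) ≤ b * s / 4 + 10 * ρ e, ?_, fun e he => ?_,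
    fun e he j hj => ?_⟩
  · have hzx : dist z x ≤ 3 * r / 8 + 2 * s := by linarith [dist_triangle z c x]
    obtain ⟨y, hy, hyr⟩ := hout
    have h1 := le_sum_radii_of_isPreconnected hc hzK (σ := b * s / 4)
      ⟨y, hy, by linarith [dist_triangle y z x]⟩
      (Finset.univ.filter fun e => dist z (p e) ≤ b * s / 4 + 10 * ρ e) (p := p)
      (ρ := fun e => 10 * ρ e) (fun e => by have := hρ e; positivity) (fun w hw hwz => by
        obtain ⟨e, he⟩ := hcov w hw (by linarith [dist_triangle w z x])
        refine ⟨e, Finset.mem_filter.2 ⟨Finset.mem_univ _, ?_⟩, he⟩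
        linarith [dist_triangle_left z (p e) w])
    have h2 : ∑ e with dist z (p e) ≤ b * s / 4 + 10 * ρ e, 80 * ρ e
        = 4 * ∑ e with dist z (p e) ≤ b * s / 4 + 10 * ρ e, 2 * (10 * ρ e) := by
      rw [Finset.mul_sum]
      exact Finset.sum_congr rfl fun e _ => by ring
    rw [h2]; linarith
  · have he' := (Finset.mem_filter.1 he).2
    have h1 := dist_triangle_left c (p e) z
    have h2 := hsafe e (by linarith)
    exact ⟨h2, by linarith⟩
  · have he' := (Finset.mem_filter.1 he).2
    have h1 : b * s / 2 ≤ dist (p j) z := by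
      by_contra! hcon
      have h2 := hS j hj (by linarith [dist_triangle (p j) z c])
      have h3 := infDist_le_infDist_add_dist (s := ℓ) (x := z) (y := p j)
      rw [dist_comm] at h3
      linarith
    have h2 := dist_triangle_right (p j) z (p e)
    linarith

lemma card_scales_mul_sq_le {V : Type*} [NormedAddCommGroup V] [InnerProductSpace ℝ V]
    [Nontrivial V] {K : Set V} (hc : IsPreconnected K) {x : V} (hx : x ∈ K) {r : ℝ} (hr : 0 < r)
    (hout : ∃ y ∈ K, r < dist y x) {ι : Type*} [Fintype ι] {p : ι → V} {ρ : ι → ℝ}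
    (hρ : ∀ e, 0 < ρ e) (hρr : ∀ e, ρ e ≤ (1 / 2) ^ 30 * r)
    (hcov : ∀ y ∈ K, dist y x ≤ r / 2 → ∃ e, dist y (p e) ≤ 10 * ρ e)
    (hsum : ∑ e, ρ e ≤ 7 * r) (sel : Finset ι)
    (hnon : ∀ s : Finset ι, Disjoint s sel → ∑ e ∈ s, ρ e ≤ (1 / 2) ^ 30 * r)
    (hsep : ∀ i ∈ sel, ∀ j ∈ sel, i ≠ j → ρ i + ρ j ≤ dist (p i) (p j))
    {b : ℝ} (hb : 0 < b) (hb1 : b < 1) (G : ι → Finset ℕ)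
    (hGr : ∀ i ∈ sel, ∀ k ∈ G i, (1 / 2) ^ k ≤ r / 128)
    (hGρ : ∀ i ∈ sel, ∀ k ∈ G i, ρ i ≤ (1 / 2) ^ k)
    (hsafe : ∀ i ∈ sel, ∀ k ∈ G i, ∀ j ∈ sel,
      dist (p i) (p j) ≤ 3 * (1 / 2) ^ k + 10 * ρ j → ρ j ≤ (1 / 2) ^ k)
    (hline : ∀ i ∈ sel, ∀ k ∈ G i, ∀ ℓ : Set V, IsLine ℓ →
      ∃ z ∈ K, dist z (p i) ≤ 2 * (1 / 2) ^ k ∧ b * (1 / 2) ^ k ≤ infDist z ℓ)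
    {n : ℕ} (hn : ∀ i ∈ sel, n ≤ (G i).card) : n * b ^ 2 ≤ 2 ^ 55 := by
  classical
  obtain ⟨e₁, -⟩ := hcov x hx (by simp; positivity)
  have : Nonempty ι := ⟨e₁⟩
  obtain ⟨e₂, he₂⟩ := Finite.exists_min ρ
  obtain ⟨q, hq⟩ := exists_pow_lt_of_lt_one (hρ e₂) (show (1 / 2 : ℝ) < 1 by norm_num)
  have hερ : ∀ e, (1 / 2 : ℝ) ^ q ≤ ρ e := fun e => hq.le.trans (he₂ e)
  have hε : (0 : ℝ) < (1 / 2) ^ q := by positivity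
  obtain ⟨P, τ, T, γ, hPx, hγ, hγτ, hγT, hτ, hT, hmass⟩ := exists_efficient_path hc hx hr hout
    (p := p) (ρ := ρ) (fun e => (hρr e).trans (by linarith)) hcov hsum hε hερ
  have hγd : ∀ m n : ℕ, dist (γ m) (γ n) ≤ (1 / 2) ^ q * |(m : ℝ) - n| := by
    have key : ∀ m n : ℕ, m ≤ n → dist (γ m) (γ n) ≤ (1 / 2) ^ q * |(m : ℝ) - n| := by
      intro m n hmn
      refine (dist_le_Ico_sum_of_dist_le (d := fun _ => (1 / 2 : ℝ) ^ q) hmn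
        fun _ _ => ?_).trans ?_
      · rw [dist_comm, dist_eq_norm]; exact hγ _
      · rw [Finset.sum_const, Nat.card_Ico, nsmul_eq_mul, Nat.cast_sub hmn, mul_comm,
          abs_sub_comm, abs_of_nonneg (by rw [sub_nonneg]; exact_mod_cast hmn)]
    intro m n
    rcases le_total m n with h | h
    · exact key m n h
    · rw [dist_comm, abs_sub_comm]; exact key n m h
  set S₀ := P.filter fun i => i ∈ sel with hS₀
  have hS₀P : ∀ i ∈ S₀, i ∈ P := fun i hi => (Finset.mem_filter.1 hi).1
  have hS₀s : ∀ i ∈ S₀, i ∈ sel := fun i hi => (Finset.mem_filter.1 hi).2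
  have hsepτ : ∀ i ∈ S₀, ∀ j ∈ S₀, i ≠ j → ρ i + ρ j ≤ (1 / 2) ^ q * |(τ i : ℝ) - τ j| := by
    intro i hi j hj hij
    refine (hsep i (hS₀s i hi) j (hS₀s j hj) hij).trans ?_
    have := hγd (τ i) (τ j)
    rwa [hγτ i (hS₀P i hi), hγτ j (hS₀P j hj)] at this
  set near : ι → ι → Prop := fun i v => dist (p i) (p v) ≤ 20 * ρ v ∧ ρ i < ρ v with hnear
  set S := S₀.filter fun i => ∀ v, v ∉ sel → ¬ near i v with hS
  have hSS₀ : ∀ i ∈ S, i ∈ S₀ := fun i hi => (Finset.mem_filter.1 hi).1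
  have hSmass : r / 400 ≤ ∑ i ∈ S, ρ i := by
    have h1 : ∑ i ∈ P, ρ i = ∑ i ∈ S₀, ρ i + ∑ i ∈ P with i ∉ sel, ρ i :=
      (Finset.sum_filter_add_sum_filter_not P _ _).symm
    have h2 : ∑ i ∈ S₀, ρ i = ∑ i ∈ S, ρ i
        + ∑ i ∈ S₀ with ¬ ∀ v, v ∉ sel → ¬ near i v, ρ i :=
      (Finset.sum_filter_add_sum_filter_not S₀ _ _).symm
    have h3 : ∑ i ∈ P with i ∉ sel, ρ i ≤ (1 / 2) ^ 30 * r := by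
      refine hnon _ (Finset.disjoint_left.2 fun i hi hi' => (Finset.mem_filter.1 hi).2 hi')
    have h4 : ∑ i ∈ S₀ with ¬ ∀ v, v ∉ sel → ¬ near i v, ρ i
        ≤ ∑ v with v ∉ sel, ∑ i ∈ S₀ with near i v, ρ i := by
      have e1 : ∀ v, ∑ i ∈ S₀ with near i v, ρ i = ∑ i ∈ S₀, if near i v then ρ i else 0 :=
        fun v => Finset.sum_filter _ _
      simp only [e1]
      rw [Finset.sum_comm, Finset.sum_filter]
      refine Finset.sum_le_sum fun i _ => ?_
      have h0 : ∀ v ∈ Finset.univ.filter fun v => v ∉ sel, 0 ≤ if near i v then ρ i else 0 :=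
        fun v _ => by
          have := (hρ i).le
          split_ifs <;> simp [this]
      split_ifs with h
      · exact Finset.sum_nonneg h0
      · push Not at h
        obtain ⟨v, hv, hiv⟩ := h
        have := Finset.single_le_sum h0 (Finset.mem_filter.2 ⟨Finset.mem_univ v, hv⟩)
        rwa [if_pos hiv] at this
    have h5 : ∀ v, ∑ i ∈ S₀ with near i v, ρ i ≤ 42 * 2 ^ 13 * ρ v := by
      intro v
      have hv := hρ v
      refine (sum_le_of_pairwise_add_le_abs (X := 41 * 2 ^ 13 * ρ v) (D := ρ v)
        (t := fun i => (1 / 2) ^ q * (τ i : ℝ)) _ (fun i _ => (hρ i).le) (fun i hi => ?_)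
        (fun i hi j hj hij => ?_) (fun i hi j hj => ?_) (by positivity)).trans ?_
      · exact (Finset.mem_filter.1 hi).2.2.le
      · rw [← mul_sub, abs_mul, abs_of_pos hε]
        exact hsepτ i (Finset.mem_filter.1 hi).1 j (Finset.mem_filter.1 hj).1 hij
      · obtain ⟨hi, hi', -⟩ := Finset.mem_filter.1 hi
        obtain ⟨hj, hj', -⟩ := Finset.mem_filter.1 hj
        rw [← mul_sub, abs_mul, abs_of_pos hε]
        have h1 := hτ i (hS₀P i hi) j (hS₀P j hj)
        have h4 := dist_triangle_right (p i) (p j) (p v)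
        have := hερ v
        linarith
      · linarith
    have h6 : ∑ v with v ∉ sel, ∑ i ∈ S₀ with near i v, ρ i
        ≤ 42 * 2 ^ 13 * ((1 / 2) ^ 30 * r) := by
      refine (Finset.sum_le_sum fun v _ => h5 v).trans ?_
      rw [← Finset.mul_sum]
      refine mul_le_mul_of_nonneg_left (hnon _ ?_) (by norm_num)
      exact Finset.disjoint_left.2 fun i hi hi' => (Finset.mem_filter.1 hi).2 hi'
    norm_num at h3 h6
    linarith
  have hSsafe : ∀ i ∈ S, ∀ k ∈ G i, ∀ e, dist (p i) (p e) ≤ 3 * (1 / 2) ^ k + 10 * ρ e →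
      ρ e ≤ (1 / 2) ^ k := by
    intro i hi k hk e he
    have his := hS₀s i (hSS₀ i hi)
    by_cases hes : e ∈ sel
    · exact hsafe i his k hk e hes he
    · by_contra! hcon
      exact (Finset.mem_filter.1 hi).2 e hes
        ⟨by linarith [hρ e], (hGρ i his k hk).trans_lt hcon⟩
  set curved : ι → ℕ → Prop := fun i k => ∀ a : ℕ,
    (2 : ℝ) ^ (q + 16) + τ i ≤ a + 2 ^ (q - k + 15) →
      (a : ℝ) + 2 ^ (q - k + 15) < 2 ^ (q + 16) + τ i + 2 ^ q * ρ i →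
      b / 4 * (1 / 2) ^ k < devBound (fun n => γ (n - 2 ^ (q + 16))) (q - k + 16) a with hcurved
  have hkq : ∀ i ∈ S, ∀ k ∈ G i, k ≤ q := by
    intro i hi k hk
    have h1 := (hερ i).trans (hGρ i (hS₀s i (hSS₀ i hi)) k hk)
    exact (pow_le_pow_iff_right_of_lt_one₀ (by norm_num) (by norm_num)).1 h1
  have hA := sum_radii_mul_card_curved_le S hγ hγT (fun i _ => hρ i)
    (fun i hi j hj => hsepτ i (hSS₀ i hi) j (hSS₀ j hj)) (η := b / 4) (by positivity)
    (fun i => (G i).filter (curved i)) (fun i hi k hk => hkq i hi k (Finset.mem_filter.1 hk).1)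
    (fun i _ k hk => (Finset.mem_filter.1 hk).2)
  have hflat : ∀ i k, ∃ F : Finset ι, i ∈ S → k ∈ (G i).filter (fun k => ¬ curved i k) →
      b * (1 / 2) ^ k ≤ ∑ e ∈ F, 80 * ρ e ∧
      (∀ e ∈ F, ρ e ≤ (1 / 2) ^ k ∧ dist (p i) (p e) ≤ 13 * (1 / 2) ^ k) ∧
      ∀ e ∈ F, ∀ j ∈ S, b * (1 / 2) ^ k / 4 ≤ dist (p j) (p e) + 10 * ρ e := by
    intro i k
    by_cases hik : i ∈ S ∧ k ∈ (G i).filter (fun k => ¬ curved i k)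
    swap
    · exact ⟨∅, fun h1 h2 => absurd ⟨h1, h2⟩ hik⟩
    obtain ⟨hi, hk⟩ := hik
    obtain ⟨hk, hcur⟩ := Finset.mem_filter.1 hk
    have his := hS₀s i (hSS₀ i hi)
    have hiP := hS₀P i (hSS₀ i hi)
    simp only [hcurved] at hcur
    push Not at hcur
    obtain ⟨a, ha1, ha2, ha3⟩ := hcur
    obtain ⟨ℓ, hℓ, hwin⟩ := exists_line_near_window (fun n => γ (n - 2 ^ (q + 16))) (q - k + 16) a
    obtain ⟨z, hzK, hz1, hz2⟩ := hline i his k hk ℓ hℓ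
    have hs : (0 : ℝ) < (1 / 2) ^ k := by positivity
    obtain ⟨F, hF⟩ := exists_cover_of_flat hc hout hρ hcov (hPx i hiP) hs (hGr i his k hk) hb hb1
      (hSsafe i hi k hk) hzK hz1 hz2 (S := S) (fun j hj hji => by
        have hjP := hS₀P j (hSS₀ j hj)
        have h1 := hτ j hjP i hiP
        have h2 := hGρ i his k hk
        have h3 := hερ i
        have h2q : (2 : ℝ) ^ q * (1 / 2) ^ q = 1 := by rw [← mul_pow]; norm_num
        have h2q0 : (0 : ℝ) < 2 ^ q := by positivity
        have e1 : (2 : ℝ) ^ (q - k + 15) = 2 ^ q * (2 ^ 15 * (1 / 2) ^ k) := by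
          obtain ⟨l, rfl⟩ := Nat.exists_eq_add_of_le (hkq i hi k hk)
          rw [Nat.add_sub_cancel_left]
          have : (2 : ℝ) ^ k * (1 / 2) ^ k = 1 := by rw [← mul_pow]; norm_num
          calc (2 : ℝ) ^ (l + 15) = 2 ^ l * 2 ^ 15 * (2 ^ k * (1 / 2) ^ k) := by
                rw [this]; ring
            _ = _ := by ring
        have h4 : |(τ j : ℝ) - τ i| + 2 ^ q * ρ i ≤ 2 ^ (q - k + 15) := by
          have h5 : (1 / 2) ^ q * |(τ j : ℝ) - τ i| + ρ i ≤ 2 ^ 15 * (1 / 2) ^ k := by linarith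
          have h6 := mul_le_mul_of_nonneg_left h5 h2q0.le
          rw [← e1, mul_add, ← mul_assoc, h2q, one_mul] at h6
          exact h6
        have h5 := abs_le.1 (show |(τ j : ℝ) - τ i| ≤ 2 ^ (q - k + 15) - 2 ^ q * ρ i by linarith)
        have h6 : 0 < 2 ^ q * ρ i := mul_pos h2q0 (hρ i)
        have e2 : (2 : ℝ) ^ (q - k + 16) = 2 * 2 ^ (q - k + 15) := by rw [pow_succ]; ring
        have h7 : a ≤ 2 ^ (q + 16) + τ j := by
          have : (a : ℝ) ≤ 2 ^ (q + 16) + τ j := by linarith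
          exact_mod_cast this
        have h8 : 2 ^ (q + 16) + τ j - a ≤ 2 ^ (q - k + 16) := by
          rw [Nat.sub_le_iff_le_add]
          have : (2 : ℝ) ^ (q + 16) + τ j ≤ 2 ^ (q - k + 16) + a := by linarith
          exact_mod_cast this
        have h9 := hwin _ h8
        simp only [Nat.add_sub_cancel' h7, Nat.add_sub_cancel_left, hγτ j hjP] at h9
        exact h9.trans ha3)
    exact ⟨F, fun _ _ => hF⟩
  choose F hF using hflat
  have hB := sum_radii_mul_card_flat_le S hε.le hερ
    (fun i hi j hj => hsepτ i (hSS₀ i hi) j (hSS₀ j hj))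
    (fun i hi j hj => hτ i (hS₀P i (hSS₀ i hi)) j (hS₀P j (hSS₀ j hj))) hb
    (fun i => (G i).filter fun k => ¬ curved i k) F
    (fun i hi k hk => hGρ i (hS₀s i (hSS₀ i hi)) k (Finset.mem_filter.1 hk).1)
    (fun i hi k hk => (hF i k hi hk).1) (fun i hi k hk => (hF i k hi hk).2.1)
    (fun i hi k hk => (hF i k hi hk).2.2)
  have hcount : (n : ℝ) * ∑ i ∈ S, ρ i ≤ ∑ i ∈ S, ρ i * ((G i).filter (curved i)).card
      + ∑ i ∈ S, ρ i * ((G i).filter fun k => ¬ curved i k).card := by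
    rw [← Finset.sum_add_distrib, Finset.mul_sum]
    refine Finset.sum_le_sum fun i hi => ?_
    rw [← mul_add, mul_comm]
    refine mul_le_mul_of_nonneg_left ?_ (hρ i).le
    have h1 := Finset.card_filter_add_card_filter_not (s := G i) (curved i)
    have h2 := hn i (hS₀s i (hSS₀ i hi))
    rw [← h1] at h2
    exact_mod_cast h2
  have hb2 : 0 < b ^ 2 := by positivity
  have h1 := mul_le_mul_of_nonneg_left hcount hb2.le
  have h2 : (n : ℝ) * b ^ 2 * (r / 400) ≤ b ^ 2 * (n * ∑ i ∈ S, ρ i) := by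
    have := mul_le_mul_of_nonneg_left hSmass (show 0 ≤ (n : ℝ) * b ^ 2 by positivity)
    linarith
  have h3 : (n : ℝ) * b ^ 2 * r ≤ 2 ^ 55 * r := by
    have e : (b / 4) ^ 2 = b ^ 2 / 16 := by ring
    rw [e] at hA
    norm_num at hA hB hT ⊢
    linarith
  exact le_of_mul_le_mul_right h3 hr

/-! ### Multiscale weights -/

/-- The partial sums over scales of a family of functions. -/
def scaleSum {V : Type*} (f : ℕ → V → ℝ) (n : ℕ) (y : V) : ℝ := ∑ k ∈ Finset.range n, f k y

/-- The weight of the ball of radius `2 ^ (-n)` around `y`. -/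
def scaleWeight {V : Type*} (f : ℕ → V → ℝ) (θ : ℝ) (v : V × ℕ) : ℝ :=
  (1 / 2) ^ v.2 * Real.exp (-(θ * scaleSum f v.2 v.1))

lemma scaleWeight_nonneg {V : Type*} (f : ℕ → V → ℝ) (θ : ℝ) (v : V × ℕ) :
    0 ≤ scaleWeight f θ v := by
  unfold scaleWeight; positivity

section Content

variable {V : Type*} [NormedAddCommGroup V] [InnerProductSpace ℝ V]

/-- A family of functions with values in `[0, 1]`, the `k`-th one being `2 ^ k`-Lipschitz and
supported near points around which `K` is `b`-far from every line at scale `2 ^ (-k)`. -/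
structure IsScaleFamily (K : Set V) (b : ℝ) (f : ℕ → V → ℝ) : Prop where
  nonneg : ∀ k y, 0 ≤ f k y
  le_one : ∀ k y, f k y ≤ 1
  lip : ∀ k y z, f k y ≤ f k z + 2 ^ k * dist y z
  far : ∀ k, ∀ y ∈ K, 0 < f k y → ∀ ℓ : Set V, IsLine ℓ →
    ∃ z ∈ K, dist z y ≤ 2 * (1 / 2) ^ k ∧ b * (1 / 2) ^ k ≤ infDist z ℓ

variable {K : Set V} {b : ℝ} {f : ℕ → V → ℝ}

lemma IsScaleFamily.sum_mono (hf : IsScaleFamily K b f) {m n : ℕ} (h : m ≤ n) (y : V) :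
    scaleSum f m y ≤ scaleSum f n y :=
  Finset.sum_le_sum_of_subset_of_nonneg (Finset.range_mono h) fun k _ _ => hf.nonneg k y

lemma IsScaleFamily.sum_add_le (hf : IsScaleFamily K b f) (m n : ℕ) (y : V) :
    scaleSum f (m + n) y ≤ scaleSum f m y + n := by
  rw [scaleSum, Finset.sum_range_add, scaleSum]
  gcongr
  calc ∑ k ∈ Finset.range n, f (m + k) y ≤ ∑ k ∈ Finset.range n, (1 : ℝ) :=
        Finset.sum_le_sum fun k _ => hf.le_one _ _
    _ = n := by simp

lemma IsScaleFamily.sum_lip (hf : IsScaleFamily K b f) (n : ℕ) (y z : V) :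
    scaleSum f n y ≤ scaleSum f n z + 2 ^ n * dist y z := by
  have h : scaleSum f n y ≤ scaleSum f n z + (2 ^ n - 1) * dist y z := by
    induction n with
    | zero => simp [scaleSum]
    | succ n ih =>
      simp only [scaleSum, Finset.sum_range_succ] at ih ⊢
      have := hf.lip n y z
      rw [pow_succ]
      linarith
  linarith [dist_nonneg (x := y) (y := z)]

lemma IsScaleFamily.sum_le_add (hf : IsScaleFamily K b f) {n : ℕ} {y z : V} {C : ℝ}
    (h : dist y z ≤ C * (1 / 2) ^ n) : scaleSum f n y ≤ scaleSum f n z + C := by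
  refine (hf.sum_lip n y z).trans ?_
  gcongr
  calc (2 : ℝ) ^ n * dist y z ≤ 2 ^ n * (C * (1 / 2) ^ n) := by gcongr
    _ = C := by rw [one_div, inv_pow]; field_simp

lemma exp_neg_mul_le {θ s t u : ℝ} (hθ : 0 ≤ θ) (h : s ≤ t + u) (hu : θ * u ≤ 1) :
    Real.exp (-(θ * t)) ≤ 3 * Real.exp (-(θ * s)) := by
  have h1 : Real.exp (-(θ * t)) ≤ Real.exp (1 + -(θ * s)) := by
    gcongr
    nlinarith [mul_le_mul_of_nonneg_left h hθ]
  rw [Real.exp_add] at h1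
  exact h1.trans (mul_le_mul_of_nonneg_right Real.exp_one_lt_three.le (Real.exp_nonneg _))

lemma exists_scales {g : ℕ → ℝ} (h0 : ∀ k, 0 ≤ g k) (h1 : ∀ k, g k ≤ 1) (a : ℕ) {n : ℕ} {t : ℝ}
    (ht : t ≤ ∑ k ∈ Finset.range n, g k) :
    ∃ G : Finset ℕ, (∀ k ∈ G, a ≤ k ∧ ∑ l ∈ Finset.range k, g l < t ∧ 0 < g k) ∧
      t - ∑ k ∈ Finset.range a, g k ≤ G.card := by
  classical
  have hex : ∃ n, t ≤ ∑ k ∈ Finset.range n, g k := ⟨n, ht⟩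
  have hmin := fun k => Nat.find_min hex (m := k)
  have hfind := Nat.find_spec hex
  generalize Nat.find hex = N at hmin hfind
  refine ⟨(Finset.Ico a N).filter fun k => 0 < g k, fun k hk => ?_, ?_⟩
  · obtain ⟨hk, hk'⟩ := Finset.mem_filter.1 hk
    obtain ⟨h2, h3⟩ := Finset.mem_Ico.1 hk
    exact ⟨h2, not_le.1 (hmin k h3), hk'⟩
  · rcases le_total N a with h | h
    · have := Finset.sum_le_sum_of_subset_of_nonneg (Finset.range_mono h) (f := g)
        fun k _ _ => h0 k
      have : (0 : ℝ) ≤ ((Finset.Ico a N).filter fun k => 0 < g k).card := by positivity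
      linarith
    · rw [← Finset.sum_range_add_sum_Ico g h] at hfind
      have : ∑ k ∈ Finset.Ico a N, g k ≤ ((Finset.Ico a N).filter fun k => 0 < g k).card := by
        rw [Finset.card_filter, Nat.cast_sum]
        refine Finset.sum_le_sum fun k _ => ?_
        split_ifs with hk
        · simpa using h1 k
        · simpa using hk
      linarith

lemma exists_finset_disjoint_closedBall {Y : Set V} (hY : IsCompact Y) {R : V → ℝ}
    (hR : ∀ y ∈ Y, 0 < R y) :
    ∃ I : Finset V, (∀ i ∈ I, i ∈ Y) ∧ (∀ i ∈ I, ∀ j ∈ I, i ≠ j → R i + R j < dist i j) ∧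
      ∀ y ∈ Y, ∃ i ∈ I, dist y i ≤ 5 * R i := by
  classical
  obtain ⟨t, htY, ht⟩ := hY.elim_nhds_subcover (fun y => closedBall y (R y))
    fun y hy => closedBall_mem_nhds y (hR y hy)
  obtain ⟨u, hut, hdis, hu⟩ := Vitali.exists_disjoint_subfamily_covering_enlargement_closedBall
    (t : Set V) id R (∑ i ∈ t, R i)
    (fun a ha => Finset.single_le_sum (fun i hi => (hR i (htY i hi)).le) ha) 5 (by norm_num)
  have hfin : u.Finite := t.finite_toSet.subset hut
  have hmem : ∀ i, i ∈ hfin.toFinset ↔ i ∈ u := fun i => hfin.mem_toFinset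
  simp only [id] at hdis hu
  refine ⟨hfin.toFinset, fun i hi => htY i (hut ((hmem i).1 hi)), fun i hi j hj hij => ?_,
    fun y hy => ?_⟩
  · rw [hmem] at hi hj
    exact (disjoint_closedBall_closedBall_iff (hR i (htY i (hut hi))).le
      (hR j (htY j (hut hj))).le).1 (hdis hi hj hij)
  · obtain ⟨a, hat, ha⟩ := mem_iUnion₂.1 (ht hy)
    obtain ⟨i, hi, hai⟩ := hu a hat
    exact ⟨i, (hmem i).2 hi, hai ha⟩

end Content

section Content

variable {V : Type*} [NormedAddCommGroup V] [InnerProductSpace ℝ V] {K : Set V} {b : ℝ}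
  {f : ℕ → V → ℝ}

lemma IsScaleFamily.scaleWeight_le_of_dist_le (hf : IsScaleFamily K b f) {θ : ℝ} (hθ : 0 ≤ θ)
    (hθ1 : θ ≤ 1 / 2) {x c : V} {m n : ℕ} (hnm : n ≤ m) (h : dist c x ≤ 2 * (1 / 2) ^ n) :
    scaleWeight f θ (x, m) ≤ 3 * scaleWeight f θ (c, n) := by
  have h1 : scaleSum f n c ≤ scaleSum f m x + 2 :=
    (hf.sum_le_add h).trans (by gcongr; exact hf.sum_mono hnm x)
  have h2 := exp_neg_mul_le hθ h1 (by linarith)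
  have h3 : ((1 : ℝ) / 2) ^ m ≤ (1 / 2) ^ n :=
    pow_le_pow_of_le_one (by norm_num) (by norm_num) hnm
  simp only [scaleWeight]
  calc _ ≤ ((1 : ℝ) / 2) ^ n * (3 * Real.exp (-(θ * scaleSum f n c))) := by gcongr
    _ = _ := by ring

lemma IsScaleFamily.exists_stopping_index (hf : IsScaleFamily K b f) {x y : V} {m N n : ℕ}
    (hy : dist y x ≤ (1 / 2) ^ m) (hN : 2 ≤ N) (hn : scaleSum f m x + N ≤ scaleSum f n y) :
    ∃ k, k ≤ n ∧ m + N ≤ k + 1 ∧ scaleSum f m x + N ≤ scaleSum f k y ∧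
      scaleSum f k y ≤ scaleSum f m x + N + 1 := by
  have hex : ∃ n, scaleSum f m x + N ≤ scaleSum f n y := ⟨n, hn⟩
  have hmin := fun k => Nat.find_min hex (m := k)
  have hfind := Nat.find_spec hex
  have hle := Nat.find_min' hex hn
  generalize Nat.find hex = k at hmin hfind hle
  have h0 : scaleSum f m y ≤ scaleSum f m x + 1 := hf.sum_le_add (by linarith)
  have hmk : m < k := by
    by_contra! hkm
    have := hf.sum_mono hkm y
    have : (2 : ℝ) ≤ N := by exact_mod_cast hN
    linarith
  obtain ⟨j, rfl⟩ := Nat.exists_eq_add_of_lt hmk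
  refine ⟨_, hle, ?_, hfind, ?_⟩
  · have h1 := hf.sum_add_le m (j + 1) y
    rw [← add_assoc] at h1
    have : (N : ℝ) ≤ (j : ℝ) + 2 := by push_cast at h1; linarith
    have : N ≤ j + 2 := by exact_mod_cast this
    omega
  · have h1 := hf.sum_add_le (m + j) 1 y
    have h2 := hmin (m + j) (by omega)
    push_cast at h1
    linarith

lemma IsScaleFamily.card_mul_sq_le [Nontrivial V] (hf : IsScaleFamily K b f)
    (hc : IsPreconnected K) {x : V} (hx : x ∈ K) {m : ℕ}
    (hout : ∃ y ∈ K, (1 / 2) ^ m < dist y x) (hb : 0 < b) (hb1 : b < 1) {N : ℕ} (hN : 32 ≤ N)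
    (I : Finset V) (n : V → ℕ) (hIK : ∀ i ∈ I, i ∈ K)
    (hIx : ∀ i ∈ I, dist i x ≤ (1 / 2) ^ m) (hIn : ∀ i ∈ I, m + (N + 28) ≤ n i + 1)
    (hIS : ∀ i ∈ I, scaleSum f m x + (N + 28) ≤ scaleSum f (n i) i)
    (hdis : ∀ i ∈ I, ∀ j ∈ I, i ≠ j → (1 / 2) ^ n i + (1 / 2) ^ n j ≤ dist i j)
    (B : Finset (V × ℕ)) (hB : ∑ v ∈ B, (1 / 2 : ℝ) ^ v.2 ≤ (1 / 2) ^ 30 * (1 / 2) ^ m)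
    (hsum : ∑ i ∈ I, (1 / 2 : ℝ) ^ n i ≤ 6 * (1 / 2) ^ m)
    (hcov : ∀ y ∈ K, dist y x ≤ (1 / 2) ^ m / 2 → (∃ i ∈ I, dist y i ≤ 5 * (1 / 2) ^ n i) ∨
      ∃ v ∈ B, dist y v.1 ≤ 10 * (1 / 2) ^ v.2) : N * b ^ 2 ≤ 2 ^ 55 := by
  classical
  have hscales : ∀ i : V, ∃ G : Finset ℕ, i ∈ I →
      (∀ k ∈ G, m + 7 ≤ k ∧ scaleSum f k i < scaleSum f m x + (N + 8) ∧ 0 < f k i) ∧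
        N ≤ G.card := by
    intro i
    by_cases hi : i ∈ I
    swap
    · exact ⟨∅, fun h => absurd h hi⟩
    obtain ⟨G, hG, hcard⟩ := exists_scales (g := fun k => f k i) (fun k => hf.nonneg k i)
      (fun k => hf.le_one k i) (m + 7) (n := n i) (t := scaleSum f m x + (N + 8))
      (le_trans (by linarith) (hIS i hi))
    refine ⟨G, fun _ => ⟨hG, ?_⟩⟩
    have h1 : scaleSum f (m + 7) i ≤ scaleSum f m x + 8 := by
      have h2 := hf.sum_add_le m 7 i
      have h3 : scaleSum f m i ≤ scaleSum f m x + 1 := hf.sum_le_add (by linarith [hIx i hi])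
      push_cast at h2
      linarith
    rw [scaleSum] at h1
    have : (N : ℝ) ≤ G.card := by linarith
    exact_mod_cast this
  choose G hG using hscales
  have hkn : ∀ i ∈ I, ∀ k ∈ G i, k ≤ n i := by
    intro i hi k hk
    by_contra! h
    have h1 := hf.sum_mono h.le i
    have h2 := hIS i hi
    have h3 := ((hG i hi).1 k hk).2.1
    linarith
  have hpow : ∀ {a c : ℕ}, a ≤ c → ((1 : ℝ) / 2) ^ c ≤ (1 / 2) ^ a := fun h =>
    pow_le_pow_of_le_one (by norm_num) (by norm_num) h
  set p : I ⊕ B → V := Sum.elim (fun i => i.1) fun v => v.1.1 with hp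
  set ρ : I ⊕ B → ℝ := Sum.elim (fun i => (1 / 2) ^ n i.1) fun v => (1 / 2) ^ v.1.2 with hρ
  have hsumB : ∑ v : B, (1 / 2 : ℝ) ^ v.1.2 ≤ (1 / 2) ^ 30 * (1 / 2) ^ m := by
    rwa [Finset.sum_coe_sort B fun v => (1 / 2 : ℝ) ^ v.2]
  have hsel : ∀ e : I ⊕ B, e ∈ Finset.univ.filter (fun e : I ⊕ B => e.isLeft = true) →
      ∃ i : I, e = Sum.inl i := by
    rintro (i | v) he
    · exact ⟨i, rfl⟩
    · simp at he
  refine card_scales_mul_sq_le hc hx (r := (1 / 2) ^ m) (by positivity) hout (p := p) (ρ := ρ)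
    ?_ ?_ ?_ ?_ (Finset.univ.filter fun e => e.isLeft = true) ?_ ?_ hb hb1
    (Sum.elim (fun i => G i.1) fun _ => ∅) ?_ ?_ ?_ ?_ ?_
  · rintro (i | v) <;> simp only [hρ, Sum.elim_inl, Sum.elim_inr] <;> positivity
  · rintro (i | v)
    · simp only [hρ, Sum.elim_inl]
      rw [← pow_add]
      exact hpow (by have := hIn i.1 i.2; omega)
    · simp only [hρ, Sum.elim_inr]
      exact (Finset.single_le_sum (f := fun v : V × ℕ => (1 / 2 : ℝ) ^ v.2)
        (fun _ _ => by positivity) v.2).trans hB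
  · intro y hy hyx
    rcases hcov y hy hyx with ⟨i, hi, h⟩ | ⟨v, hv, h⟩
    · refine ⟨Sum.inl ⟨i, hi⟩, h.trans ?_⟩
      simp only [hρ, Sum.elim_inl]
      have : (0 : ℝ) < (1 / 2) ^ n i := by positivity
      linarith
    · exact ⟨Sum.inr ⟨v, hv⟩, h⟩
  · rw [Fintype.sum_sum_type]
    simp only [hρ, Sum.elim_inl, Sum.elim_inr]
    rw [Finset.sum_coe_sort I fun i => (1 / 2 : ℝ) ^ n i]
    have : (0 : ℝ) < (1 / 2) ^ m := by positivity
    linarith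
  · intro s hs
    calc ∑ e ∈ s, ρ e
        ≤ ∑ e ∈ s, Sum.elim (fun _ : I => (0 : ℝ)) (fun v : B => (1 / 2) ^ v.1.2) e := by
          refine Finset.sum_le_sum ?_
          rintro (i | v) he
          · exact absurd (by simp) (Finset.disjoint_left.1 hs he)
          · exact le_rfl
      _ ≤ ∑ e, Sum.elim (fun _ : I => (0 : ℝ)) (fun v : B => (1 / 2) ^ v.1.2) e := by
          refine Finset.sum_le_sum_of_subset_of_nonneg (Finset.subset_univ s) ?_
          rintro (i | v) - -
          · exact le_rfl
          · simp only [Sum.elim_inr]; positivity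
      _ = ∑ v : B, (1 / 2 : ℝ) ^ v.1.2 := by simp [Fintype.sum_sum_type]
      _ ≤ _ := hsumB
  · intro e he e' he' hne
    obtain ⟨i, rfl⟩ := hsel e he
    obtain ⟨j, rfl⟩ := hsel e' he'
    exact hdis i.1 i.2 j.1 j.2 fun h => hne (congrArg Sum.inl (Subtype.ext h))
  · intro e he k hk
    obtain ⟨i, rfl⟩ := hsel e he
    have h1 := hpow ((hG i.1 i.2).1 k hk).1
    rw [pow_add] at h1
    norm_num at h1 ⊢
    linarith
  · intro e he k hk
    obtain ⟨i, rfl⟩ := hsel e he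
    exact hpow (hkn i.1 i.2 k hk)
  · intro e he k hk e' he' hee'
    obtain ⟨i, rfl⟩ := hsel e he
    obtain ⟨j, rfl⟩ := hsel e' he'
    simp only [hρ, hp, Sum.elim_inl] at hee' ⊢ hk
    by_contra! hlt
    have hjk : n j < k := by
      by_contra! h
      exact absurd (hpow h) (not_le.2 hlt)
    have h1 : scaleSum f (n j) j ≤ scaleSum f (n j) i + 13 := by
      refine hf.sum_le_add ?_
      rw [dist_comm]
      linarith
    have h2 := hf.sum_mono hjk.le i.1
    have h3 := hIS j.1 j.2
    have h4 := ((hG i.1 i.2).1 k hk).2.1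
    linarith
  · intro e he k hk
    obtain ⟨i, rfl⟩ := hsel e he
    exact hf.far k i.1 (hIK i.1 i.2) ((hG i.1 i.2).1 k hk).2.2
  · intro e he
    obtain ⟨i, rfl⟩ := hsel e he
    exact (hG i.1 i.2).2

end Content

theorem IsScaleFamily.scaleWeight_le_sum {V : Type*} [NormedAddCommGroup V]
    [InnerProductSpace ℝ V] [Nontrivial V] {K : Set V} {b : ℝ} {f : ℕ → V → ℝ}
    (hf : IsScaleFamily K b f) (hK : IsCompact K) (hc : IsPreconnected K) (hb : 0 < b)
    (hb1 : b < 1) {N : ℕ} (hN : 32 ≤ N) (hNb : 2 ^ 55 < N * b ^ 2) {θ : ℝ} (hθ : 0 ≤ θ)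
    (hθN : θ * (N + 38) ≤ 1) {s : Finset (V × ℕ)} (hs : ∀ v ∈ s, v.1 ∈ K) {x : V} (hx : x ∈ K)
    {m : ℕ} (hout : ∃ y ∈ K, (1 / 2) ^ m < dist y x)
    (hcov : ∀ y ∈ K, dist y x ≤ (1 / 2) ^ m → ∃ v ∈ s, dist y v.1 ≤ (1 / 2) ^ v.2) :
    (1 / 2) ^ 32 * scaleWeight f θ (x, m) ≤ ∑ v ∈ s, scaleWeight f θ v := by
  classical
  have hN' : (32 : ℝ) ≤ N := by exact_mod_cast hN
  have hθ1 : θ ≤ 1 / 2 := by nlinarith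
  suffices H : ∀ M k : ℕ, ∀ s : Finset (V × ℕ), (∀ v ∈ s, v.1 ∈ K) → (∀ v ∈ s, v.2 ≤ M) →
      ∀ x ∈ K, ∀ m : ℕ, M ≤ m + k → (∃ y ∈ K, (1 / 2) ^ m < dist y x) →
      (∀ y ∈ K, dist y x ≤ (1 / 2) ^ m → ∃ v ∈ s, dist y v.1 ≤ (1 / 2) ^ v.2) →
      (1 / 2) ^ 32 * scaleWeight f θ (x, m) ≤ ∑ v ∈ s, scaleWeight f θ v from
    H (s.sup Prod.snd) (s.sup Prod.snd) s hs (fun v hv => Finset.le_sup (f := Prod.snd) hv)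
      x hx m (Nat.le_add_left _ _) hout hcov
  clear hcov hout hx hs x m s
  intro M k
  induction k with
  | zero =>
    intro s hs hsM x hx m hm hout hcov
    obtain ⟨v, hv, hvx⟩ := hcov x hx (by simp)
    have h1 := hf.scaleWeight_le_of_dist_le hθ hθ1 (x := x) (c := v.1) (m := m) (n := v.2)
      ((hsM v hv).trans hm) (by
        rw [dist_comm]
        have : (0 : ℝ) < (1 / 2) ^ v.2 := by positivity
        linarith)
    have h2 := Finset.single_le_sum (f := scaleWeight f θ) (fun v _ => scaleWeight_nonneg f θ v) hv
    have h3 := scaleWeight_nonneg f θ v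
    norm_num
    linarith
  | succ k ih =>
    intro s hs hsM x hx m hm hout hcov
    by_cases hlow : ∃ v ∈ s, v.2 ≤ m ∧ ∃ y ∈ K, dist y x ≤ (1 / 2) ^ m ∧
        dist y v.1 ≤ (1 / 2) ^ v.2
    · obtain ⟨v, hv, hvm, y, hy, hyx, hyv⟩ := hlow
      have h0 : ((1 : ℝ) / 2) ^ m ≤ (1 / 2) ^ v.2 :=
        pow_le_pow_of_le_one (by norm_num) (by norm_num) hvm
      have h1 := hf.scaleWeight_le_of_dist_le hθ hθ1 (x := x) (c := v.1) hvm
        (by linarith [dist_triangle_left v.1 x y])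
      have h2 := Finset.single_le_sum (f := scaleWeight f θ)
        (fun v _ => scaleWeight_nonneg f θ v) hv
      have h3 := scaleWeight_nonneg f θ v
      norm_num
      linarith
    by_contra! hlt
    have hr : (0 : ℝ) < (1 / 2) ^ m := by positivity
    set E := Real.exp (-(θ * scaleSum f m x)) with hE
    have hEpos : 0 < E := Real.exp_pos _
    have hwx : scaleWeight f θ (x, m) = (1 / 2) ^ m * E := rfl
    set B := s.filter fun v => scaleSum f v.2 v.1 ≤ scaleSum f m x + (N + 38) with hBdef
    have hB : ∑ v ∈ B, (1 / 2 : ℝ) ^ v.2 ≤ (1 / 2) ^ 30 * (1 / 2) ^ m := by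
      have h1 : ∑ v ∈ B, (1 / 2 : ℝ) ^ v.2 * E ≤ ∑ v ∈ s, 3 * scaleWeight f θ v := by
        refine (Finset.sum_le_sum fun v hv => ?_).trans
          (Finset.sum_le_sum_of_subset_of_nonneg (Finset.filter_subset _ s)
            fun v _ _ => mul_nonneg (by norm_num) (scaleWeight_nonneg f θ v))
        have h2 := exp_neg_mul_le hθ (Finset.mem_filter.1 hv).2 hθN
        calc (1 / 2 : ℝ) ^ v.2 * E
            ≤ (1 / 2 : ℝ) ^ v.2 * (3 * Real.exp (-(θ * scaleSum f v.2 v.1))) := by gcongr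
          _ = _ := by rw [scaleWeight]; ring
      rw [← Finset.sum_mul, ← Finset.mul_sum] at h1
      have h2 : (∑ v ∈ B, (1 / 2 : ℝ) ^ v.2) * E ≤ ((1 / 2) ^ 30 * (1 / 2) ^ m) * E := by
        rw [hwx] at hlt
        have : 0 < (1 / 2 : ℝ) ^ m * E := by positivity
        norm_num at hlt ⊢
        linarith
      exact le_of_mul_le_mul_right h2 hEpos
    set Y := {y | y ∈ K ∧ dist y x ≤ (1 / 2) ^ m / 2 ∧
      ∀ v ∈ B, 10 * (1 / 2) ^ v.2 ≤ dist y v.1} with hYdef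
    have hYc : IsCompact Y := by
      refine hK.inter_right (s := K) (t := {y | dist y x ≤ (1 / 2) ^ m / 2 ∧
        ∀ v ∈ B, 10 * (1 / 2) ^ v.2 ≤ dist y v.1}) ?_
      simp only [ofPred_and, ofPred_forall]
      exact (isClosed_le (continuous_id.dist continuous_const) continuous_const).inter
        (isClosed_iInter fun v => isClosed_iInter fun _ =>
          isClosed_le continuous_const (continuous_id.dist continuous_const))
    have hsel : ∀ y, ∃ n, y ∈ Y → m + (N + 28) ≤ n + 1 ∧
        scaleSum f m x + (N + 28 : ℕ) ≤ scaleSum f n y ∧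
        scaleSum f n y ≤ scaleSum f m x + (N + 28 : ℕ) + 1 := by
      intro y
      by_cases hy : y ∈ Y
      swap
      · exact ⟨0, fun h => absurd h hy⟩
      obtain ⟨hyK, hyx, hyB⟩ := id hy
      obtain ⟨v, hv, hyv⟩ := hcov y hyK (by linarith)
      have hvpos : (0 : ℝ) < (1 / 2) ^ v.2 := by positivity
      have hvB : scaleSum f m x + (N + 38) < scaleSum f v.2 v.1 := by
        by_contra! h
        linarith [hyB v (Finset.mem_filter.2 ⟨hv, h⟩)]
      have h1 : scaleSum f v.2 v.1 ≤ scaleSum f v.2 y + 1 :=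
        hf.sum_le_add (by rw [dist_comm]; linarith)
      obtain ⟨n, -, h2⟩ := hf.exists_stopping_index (x := x) (y := y) (m := m) (N := N + 28)
        (n := v.2) (by linarith) (by omega) (by push_cast; linarith)
      exact ⟨n, fun _ => h2⟩
    choose n hn using hsel
    obtain ⟨I, hIY, hdis, hIcov⟩ := exists_finset_disjoint_closedBall hYc
      (R := fun y => (1 / 2) ^ n y) fun y _ => by positivity
    set near : V → V × ℕ → Prop := fun i v =>
      ∃ y ∈ K, dist y i ≤ (1 / 2) ^ (n i + 1) ∧ dist y v.1 ≤ (1 / 2) ^ v.2 with hnear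
    have hpow2 : ∀ k : ℕ, (1 / 2 : ℝ) ^ (k + 1) = (1 / 2) ^ k / 2 := fun k => by
      rw [pow_succ]; ring
    have hsmall : ∀ i ∈ I, ∀ v ∈ s, near i v → (1 / 2 : ℝ) ^ v.2 ≤ (1 / 2) ^ n i / 4 := by
      rintro i hi v hv ⟨y, hy, hyi, hyv⟩
      have hiY := hIY i hi
      by_cases hvn : n i + 2 ≤ v.2
      · calc ((1 : ℝ) / 2) ^ v.2 ≤ (1 / 2) ^ (n i + 2) :=
              pow_le_pow_of_le_one (by norm_num) (by norm_num) hvn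
          _ = _ := by rw [pow_add]; ring
      exfalso
      have hvn' : v.2 ≤ n i + 1 := by omega
      have h1 : ((1 : ℝ) / 2) ^ (n i + 1) ≤ (1 / 2) ^ v.2 :=
        pow_le_pow_of_le_one (by norm_num) (by norm_num) hvn'
      have hd : dist v.1 i ≤ 2 * (1 / 2) ^ v.2 := by linarith [dist_triangle_left v.1 i y]
      have h2 : scaleSum f v.2 v.1 ≤ scaleSum f v.2 i + 2 := hf.sum_le_add hd
      have h3 := hf.sum_mono hvn' i
      have h4 := hf.sum_add_le (n i) 1 i
      have h5 := (hn i hiY).2.2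
      push_cast at h4 h5
      have h6 := hiY.2.2 v (Finset.mem_filter.2 ⟨hv, by linarith⟩)
      rw [dist_comm] at h6
      have : (0 : ℝ) < (1 / 2) ^ v.2 := by positivity
      linarith
    have hdisj : (I : Set V).PairwiseDisjoint fun i => s.filter (near i) := by
      intro i hi j hj hij
      refine Finset.disjoint_left.2 fun v hvi hvj => ?_
      obtain ⟨hv, hvi⟩ := Finset.mem_filter.1 hvi
      obtain ⟨-, hvj⟩ := Finset.mem_filter.1 hvj
      have h1 := hsmall i hi v hv hvi
      have h2 := hsmall j hj v hv hvj
      obtain ⟨y, -, hyi, hyv⟩ := hvi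
      obtain ⟨z, -, hzj, hzv⟩ := hvj
      have h3 := hdis i hi j hj hij
      simp only [hpow2] at hyi hzj
      have : (0 : ℝ) < (1 / 2) ^ n i := by positivity
      have : (0 : ℝ) < (1 / 2) ^ n j := by positivity
      linarith [dist_triangle_left i j v.1, dist_triangle_left v.1 i y,
        dist_triangle_left v.1 j z]
    have hsum : ∑ i ∈ I, (1 / 2 : ℝ) ^ n i ≤ 6 * (1 / 2) ^ m := by
      have h1 : ∀ i ∈ I, (1 / 2) ^ 32 * ((1 / 2 : ℝ) ^ n i * (E / 6))
          ≤ ∑ v ∈ s with near i v, scaleWeight f θ v := by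
        intro i hi
        obtain ⟨hiK, hix, -⟩ := hIY i hi
        obtain ⟨hn1, -, hn2⟩ := hn i (hIY i hi)
        have hnm : ((1 : ℝ) / 2) ^ n i ≤ (1 / 2) ^ m :=
          pow_le_pow_of_le_one (by norm_num) (by norm_num) (by omega)
        refine le_trans ?_ (ih (s.filter (near i)) (fun v hv => hs v (Finset.mem_filter.1 hv).1)
          (fun v hv => hsM v (Finset.mem_filter.1 hv).1) i hiK (n i + 1) (by omega) ?_ ?_)
        · gcongr
          have h4 := hf.sum_add_le (n i) 1 i
          push_cast at h4 hn2
          have h5 := exp_neg_mul_le hθ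
            (show scaleSum f (n i + 1) i ≤ scaleSum f m x + (N + 38) by linarith) hθN
          simp only [scaleWeight, hpow2]
          calc (1 / 2 : ℝ) ^ n i * (E / 6) = (1 / 2) ^ n i / 6 * E := by ring
            _ ≤ (1 / 2) ^ n i / 6 * (3 * Real.exp (-(θ * scaleSum f (n i + 1) i))) := by gcongr
            _ = _ := by ring
        · obtain ⟨y, hy, hyx⟩ := hout
          refine ⟨y, hy, ?_⟩
          rw [hpow2]
          linarith [dist_triangle y i x]
        · intro y hy hyi
          have hyi' := hyi
          rw [hpow2] at hyi'
          obtain ⟨v, hv, hyv⟩ := hcov y hy (by linarith [dist_triangle y i x])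
          exact ⟨v, Finset.mem_filter.2 ⟨hv, y, hy, hyi, hyv⟩, hyv⟩
      have h2 := Finset.sum_le_sum h1
      rw [← Finset.sum_biUnion hdisj] at h2
      have h3 := h2.trans (Finset.sum_le_sum_of_subset_of_nonneg
        (Finset.biUnion_subset.2 fun i _ => Finset.filter_subset _ s)
        fun v _ _ => scaleWeight_nonneg f θ v)
      rw [← Finset.mul_sum, ← Finset.sum_mul] at h3
      have h4 : (∑ i ∈ I, (1 / 2 : ℝ) ^ n i) * (E / 6) ≤ (6 * (1 / 2) ^ m) * (E / 6) := by
        rw [hwx] at hlt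
        have := (h3.trans hlt.le)
        have := le_of_mul_le_mul_left this (by positivity)
        linarith
      exact le_of_mul_le_mul_right h4 (by positivity)
    refine absurd (hf.card_mul_sq_le hc hx hout hb hb1 hN I n (fun i hi => (hIY i hi).1)
      (fun i hi => by linarith [(hIY i hi).2.1]) (fun i hi => (hn i (hIY i hi)).1)
      (fun i hi => by have := (hn i (hIY i hi)).2.1; push_cast at this; exact this)
      (fun i hi j hj hij => (hdis i hi j hj hij).le) B hB hsum ?_) (not_le.2 hNb)
    intro y hy hyx
    by_cases hyY : y ∈ Y
    · exact Or.inl (hIcov y hyY)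
    · right
      by_contra! h
      exact hyY ⟨hy, hyx, fun v hv => (h v hv).le⟩

/-! ### Distance to a far set as a scale family -/

section FarSet

variable {V : Type*} [NormedAddCommGroup V] [InnerProductSpace ℝ V]

/-- The points of `K` around which `K` is `b`-far from every line at scale `2 ^ (-k)`. -/
def farSet (K : Set V) (b : ℝ) (k : ℕ) : Set V :=
  {y | y ∈ K ∧ ∀ ℓ : Set V, IsLine ℓ →
    ∃ z ∈ K, dist z y ≤ (1 / 2) ^ k ∧ b * (1 / 2) ^ k ≤ infDist z ℓ}

open scoped Classical in
/-- A Lipschitz cutoff function equal to one on `farSet K b k`. -/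
def farFun (K : Set V) (b : ℝ) (k : ℕ) (y : V) : ℝ :=
  if (farSet K b k).Nonempty then max 0 (1 - 2 ^ k * infDist y (farSet K b k)) else 0

lemma farFun_eq_one {K : Set V} {b : ℝ} {k : ℕ} {y : V} (hy : y ∈ farSet K b k) :
    farFun K b k y = 1 := by
  rw [farFun, if_pos ⟨y, hy⟩, infDist_zero_of_mem hy]
  simp

lemma isScaleFamily_farFun (K : Set V) (b : ℝ) : IsScaleFamily K b (farFun K b) where
  nonneg k y := by
    unfold farFun
    split_ifs <;> simp
  le_one k y := by
    have := infDist_nonneg (x := y) (s := farSet K b k)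
    unfold farFun
    split_ifs
    · have h : 0 ≤ 2 ^ k * infDist y (farSet K b k) := by positivity
      exact max_le zero_le_one (by linarith)
    · exact zero_le_one
  lip k y z := by
    have h0 : 0 ≤ 2 ^ k * dist y z := by positivity
    unfold farFun
    split_ifs
    · refine max_le (add_nonneg (le_max_left _ _) h0) ?_
      have h1 : infDist z (farSet K b k) ≤ infDist y (farSet K b k) + dist y z := by
        rw [dist_comm]
        exact infDist_le_infDist_add_dist
      have h2 := mul_le_mul_of_nonneg_left h1 (show (0 : ℝ) ≤ 2 ^ k by positivity)
      have h3 := le_max_right 0 (1 - 2 ^ k * infDist z (farSet K b k))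
      linarith
    · simp only [zero_add]
      exact h0
  far k y hy hpos ℓ hℓ := by
    unfold farFun at hpos
    split_ifs at hpos with hne
    · have h1 : 0 < 1 - 2 ^ k * infDist y (farSet K b k) := by
        rcases lt_max_iff.1 hpos with h | h
        · exact absurd h (lt_irrefl _)
        · exact h
      have h2 : infDist y (farSet K b k) < (1 / 2) ^ k := by
        rw [one_div, inv_pow, ← one_div, lt_div_iff₀ (by positivity), mul_comm]
        linarith
      obtain ⟨y', hy', hyy'⟩ := (infDist_lt_iff hne).1 h2
      obtain ⟨z, hz, hzy, hzℓ⟩ := hy'.2 ℓ hℓ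
      rw [dist_comm] at hyy'
      exact ⟨z, hz, by linarith [dist_triangle z y' y], hzℓ⟩
    · exact absurd hpos (lt_irrefl _)

lemma exists_far_of_lt_betaNum {K : Set V} {x : V} (hx : x ∈ K) {r β : ℝ} (hr : 0 < r)
    (hβ : β < betaNum K x r) {ℓ : Set V} (hℓ : IsLine ℓ) :
    ∃ z ∈ K, dist z x ≤ r ∧ β * r < infDist z ℓ := by
  have h1 : betaNum K x r ≤ sSup ((fun z => infDist z ℓ) '' (K ∩ closedBall x r)) / r := by
    refine csInf_le ⟨0, ?_⟩ ⟨ℓ, hℓ, rfl⟩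
    rintro _ ⟨L, -, rfl⟩
    refine div_nonneg (Real.sSup_nonneg ?_) hr.le
    rintro _ ⟨z, -, rfl⟩
    exact infDist_nonneg
  have h2 := (lt_div_iff₀ hr).1 (hβ.trans_le h1)
  have hne : (K ∩ closedBall x r).Nonempty := ⟨x, hx, mem_closedBall_self hr.le⟩
  obtain ⟨_, ⟨z, ⟨hz, hzx⟩, rfl⟩, h⟩ := exists_lt_of_lt_csSup (hne.image _) h2
  exact ⟨z, hz, hzx, h⟩

lemma mem_farSet_of_le_betaNum {K : Set V} {x : V} (hx : x ∈ K) {r β : ℝ} (hβ : 0 < β) {k : ℕ}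
    (hrk : r ≤ (1 / 2) ^ k) (hkr : (1 / 2) ^ (k + 1) ≤ r) (h : β ≤ betaNum K x r) :
    x ∈ farSet K (β / 4) k := by
  refine ⟨hx, fun ℓ hℓ => ?_⟩
  have hr : 0 < r := lt_of_lt_of_le (by positivity) hkr
  obtain ⟨z, hz, hzx, hzℓ⟩ := exists_far_of_lt_betaNum hx hr
    (show β / 2 < betaNum K x r by linarith) hℓ
  refine ⟨z, hz, hzx.trans hrk, le_trans ?_ hzℓ.le⟩
  rw [pow_succ] at hkr
  nlinarith

lemma MeanWiggly.eventually_le_scaleSum {K : Set V} {x : V} (hx : x ∈ K) {lam κ β T : ℝ}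
    (hlam : lam ∈ Ioo (0 : ℝ) 1) (hκ : 0 < κ) (hβ : 0 < β) (hT : 0 < T)
    (hlamT : lam = (1 / 2) ^ T) (h : MeanWiggly K x lam κ β) :
    ∃ q₀ : ℕ, ∀ q, q₀ ≤ q →
      κ / (2 * (1 + T)) * q ≤ scaleSum (farFun K (β / 4)) q x := by
  classical
  obtain ⟨r₀, hr₀, hr⟩ := h
  obtain ⟨n₀, hn₀⟩ := exists_pow_lt_of_lt_one hr₀ hlam.2
  refine ⟨⌈T * (n₀ + 2)⌉₊, fun q hq => ?_⟩
  have hq' : T * (n₀ + 2) ≤ q := (Nat.le_ceil _).trans (by exact_mod_cast hq)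
  set n := ⌊(q : ℝ) / T⌋₊ with hn
  have hn1 : (n : ℝ) ≤ q / T := Nat.floor_le (by positivity)
  have hn2 : (q : ℝ) / T < n + 1 := Nat.lt_floor_add_one _
  have hn3 : n₀ ≤ n := Nat.le_floor (by rw [le_div_iff₀ hT]; nlinarith)
  have hwig := hr n ((pow_le_pow_of_le_one hlam.1.le hlam.2.le hn3).trans_lt hn₀)
  set A := (Finset.range n).filter fun m => β ≤ betaNum K x (lam ^ m) with hA
  set φ : ℕ → ℕ := fun m => ⌊T * m⌋₊ with hφ
  have hφ1 : ∀ m, (φ m : ℝ) ≤ T * m := fun m => Nat.floor_le (by positivity)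
  have hφ2 : ∀ m, T * m < φ m + 1 := fun m => Nat.lt_floor_add_one _
  have hcard : A.card ≤ ⌈1 / T⌉₊ * (A.image φ).card := by
    refine Finset.card_le_mul_card_image _ _ fun k _ => ?_
    have hsub : (A.filter fun m => φ m = k) ⊆
        Finset.Ico ⌈(k : ℝ) / T⌉₊ (⌈(k : ℝ) / T⌉₊ + ⌈1 / T⌉₊) := by
      intro m hm
      have hmk := (Finset.mem_filter.1 hm).2
      have h1 := hφ1 m
      have h2 := hφ2 m
      rw [hmk] at h1 h2
      refine Finset.mem_Ico.2 ⟨Nat.ceil_le.2 ?_, ?_⟩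
      · rw [div_le_iff₀ hT]; linarith
      · have h3 : (m : ℝ) < k / T + 1 / T := by
          rw [← add_div, lt_div_iff₀ hT]; linarith
        have := h3.trans_le (add_le_add (Nat.le_ceil _) (Nat.le_ceil _))
        exact_mod_cast this
    simpa using Finset.card_le_card hsub
  have hsum : ((A.image φ).card : ℝ) ≤ scaleSum (farFun K (β / 4)) q x := by
    have hsub : A.image φ ⊆ Finset.range q := by
      intro k hk
      obtain ⟨m, hm, rfl⟩ := Finset.mem_image.1 hk
      have hmn : m < n := Finset.mem_range.1 (Finset.mem_filter.1 hm).1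
      have h1 : (m : ℝ) + 1 ≤ n := by exact_mod_cast hmn
      have h2 : T * n ≤ q := by rw [le_div_iff₀ hT] at hn1; linarith
      have h3 : (φ m : ℝ) < q := by nlinarith [hφ1 m]
      exact Finset.mem_range.2 (by exact_mod_cast h3)
    calc ((A.image φ).card : ℝ) = ∑ k ∈ A.image φ, (1 : ℝ) := by simp
      _ = ∑ k ∈ A.image φ, farFun K (β / 4) k x := by
        refine Finset.sum_congr rfl fun k hk => (farFun_eq_one ?_).symm
        obtain ⟨m, hm, rfl⟩ := Finset.mem_image.1 hk
        have hlm : lam ^ m = (1 / 2 : ℝ) ^ (T * m) := by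
          rw [hlamT, ← Real.rpow_natCast, ← Real.rpow_mul (by norm_num)]
        refine mem_farSet_of_le_betaNum hx hβ (r := lam ^ m) ?_ ?_ (Finset.mem_filter.1 hm).2
        · rw [hlm, ← Real.rpow_natCast]
          exact Real.rpow_le_rpow_of_exponent_ge (by norm_num) (by norm_num) (hφ1 m)
        · rw [hlm, ← Real.rpow_natCast]
          refine Real.rpow_le_rpow_of_exponent_ge (by norm_num) (by norm_num) ?_
          push_cast
          exact (hφ2 m).le
      _ ≤ _ := Finset.sum_le_sum_of_subset_of_nonneg hsub
        fun k _ _ => (isScaleFamily_farFun K (β / 4)).nonneg k x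
  have hceil : (⌈1 / T⌉₊ : ℝ) ≤ 1 / T + 1 := (Nat.ceil_lt_add_one (by positivity)).le
  set X := scaleSum (farFun K (β / 4)) q x with hX
  have hX0 : 0 ≤ X := le_trans (by positivity) hsum
  have h1 : κ * n ≤ (1 / T + 1) * X := by
    have h2 : (A.card : ℝ) ≤ ⌈1 / T⌉₊ * (A.image φ).card := by exact_mod_cast hcard
    calc κ * n ≤ A.card := hwig.le
      _ ≤ _ := h2
      _ ≤ _ := by gcongr
  have h3 : (q : ℝ) / 2 ≤ T * n := by
    rw [div_lt_iff₀ hT] at hn2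
    have : (0 : ℝ) ≤ T * n₀ := by positivity
    nlinarith
  rw [div_mul_eq_mul_div, div_le_iff₀ (by positivity)]
  have h4 : T * (κ * n) ≤ (1 + T) * X := by
    calc T * (κ * n) ≤ T * ((1 / T + 1) * X) := by gcongr
      _ = (1 + T) * X := by field_simp
  nlinarith

end FarSet

/-! ### Positive measure -/

lemma exists_closedBall_hausdorffMeasure_le {V : Type*} [NormedAddCommGroup V]
    [NormedSpace ℝ V] [TopologicalSpace.SeparableSpace V] [MeasurableSpace V] [BorelSpace V]
    {E W : Set V} (hE : MeasurableSet E) (hEfin : μH[1] E < ⊤) (hWE : Disjoint W E)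
    (hW : 0 < μH[1] W) {ε : ℝ} (hε : 0 < ε) (M : ℕ) :
    ∃ x ∈ W, ∃ m, M ≤ m ∧ μH[1] (E ∩ closedBall x ((1 / 2) ^ m))
      ≤ ENNReal.ofReal (ε * (1 / 2) ^ m) := by
  by_contra! hcon
  refine hW.ne' (le_antisymm ?_ (zero_le))
  set ν := (μH[1] : Measure V).restrict E with hν
  have hνfin : IsFiniteMeasure ν := ⟨by rwa [hν, Measure.restrict_apply_univ]⟩
  have hνW : ν W = 0 := by
    rw [hν, Measure.restrict_apply' hE, hWE.inter_eq, measure_empty]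
  have hcov : ∀ j : ℕ, ∃ (u : Set V) (m : V → ℕ), u.Countable ∧ (∀ y ∈ u, j ≤ m y) ∧
      (W ⊆ ⋃ y : u, closedBall (y : V) (5 * (1 / 2) ^ m y)) ∧
      ∑' y : u, ENNReal.ofReal (10 * (1 / 2) ^ m y) ≤ ENNReal.ofReal (10 * (1 / 2) ^ j) := by
    intro j
    obtain ⟨U, hWU, hU, hνU⟩ := exists_isOpen_lt_of_lt (μ := ν) W
      (ENNReal.ofReal (ε * (1 / 2) ^ j)) (by rw [hνW, ENNReal.ofReal_pos]; positivity)
    have hm : ∀ y, ∃ m, y ∈ W → M ≤ m ∧ j ≤ m ∧ closedBall y ((1 / 2) ^ m) ⊆ U := by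
      intro y
      by_cases hy : y ∈ W
      · obtain ⟨δ, hδ, hball⟩ := nhds_basis_closedBall.mem_iff.1 (hU.mem_nhds (hWU hy))
        obtain ⟨n, hn⟩ := exists_pow_lt_of_lt_one hδ (show (1 / 2 : ℝ) < 1 by norm_num)
        refine ⟨max n (max M j), fun _ => ⟨by simp, by simp,
          (closedBall_subset_closedBall ?_).trans hball⟩⟩
        exact (pow_le_pow_of_le_one (by norm_num) (by norm_num) (le_max_left _ _)).trans hn.le
      · exact ⟨0, fun h => absurd h hy⟩
    choose m hm using hm
    obtain ⟨u, huW, hdis, hu⟩ := Vitali.exists_disjoint_subfamily_covering_enlargement_closedBall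
      W id (fun y => (1 / 2 : ℝ) ^ m y) 1
      (fun y _ => pow_le_one₀ (by norm_num) (by norm_num)) 5 (by norm_num)
    simp only [id] at hdis hu
    have hcount : u.Countable := hdis.countable_of_nonempty_interior fun y _ =>
      ⟨y, ball_subset_interior_closedBall (mem_ball_self (by positivity))⟩
    refine ⟨u, m, hcount, fun y hy => (hm y (huW hy)).2.1, fun y hy => ?_, ?_⟩
    · obtain ⟨z, hz, hyz⟩ := hu y hy
      exact mem_iUnion.2 ⟨⟨z, hz⟩, hyz (mem_closedBall_self (by positivity))⟩
    · calc ∑' y : u, ENNReal.ofReal (10 * (1 / 2) ^ m y)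
          = ∑' y : u, ENNReal.ofReal (10 / ε) * ENNReal.ofReal (ε * (1 / 2) ^ m y) := by
            refine tsum_congr fun y => ?_
            rw [← ENNReal.ofReal_mul (by positivity)]
            congr 1
            field_simp
        _ ≤ ENNReal.ofReal (10 / ε) * ∑' y : u, ν (closedBall (y : V) ((1 / 2) ^ m y)) := by
            rw [ENNReal.tsum_mul_left]
            gcongr with y
            rw [hν, Measure.restrict_apply' hE, inter_comm]
            exact (hcon y (huW y.2) (m y) (hm y (huW y.2)).1).le
        _ = ENNReal.ofReal (10 / ε) * ν (⋃ y ∈ u, closedBall y ((1 / 2) ^ m y)) := by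
            rw [measure_biUnion hcount hdis fun y _ => measurableSet_closedBall]
        _ ≤ ENNReal.ofReal (10 / ε) * ENNReal.ofReal (ε * (1 / 2) ^ j) := by
            gcongr
            exact (measure_mono (iUnion₂_subset fun y hy => (hm y (huW hy)).2.2)).trans hνU.le
        _ = _ := by
            rw [← ENNReal.ofReal_mul (by positivity)]
            congr 1
            field_simp
  choose u m hcount hmj hWu hsum using hcov
  have : ∀ j, Countable (u j) := fun j => (hcount j).to_subtype
  have hlim : Tendsto (fun j : ℕ => ENNReal.ofReal (10 * (1 / 2) ^ j)) atTop (nhds 0) := by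
    have := (tendsto_pow_atTop_nhds_zero_of_lt_one (show (0 : ℝ) ≤ 1 / 2 by norm_num)
      (by norm_num)).const_mul 10
    rw [mul_zero] at this
    simpa using ENNReal.tendsto_ofReal this
  have hdiam : ∀ j (y : u j), ediam (closedBall (y : V) (5 * (1 / 2) ^ m j y))
      ≤ ENNReal.ofReal (10 * (1 / 2) ^ m j y) := by
    intro j y
    refine ediam_le fun a ha c hc => ?_
    rw [edist_dist]
    refine ENNReal.ofReal_le_ofReal ?_
    rw [mem_closedBall] at ha hc
    linarith [dist_triangle_right a c (y : V)]
  refine (Measure.hausdorffMeasure_le_liminf_tsum 1 W _ hlim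
    (fun j (y : u j) => closedBall (y : V) (5 * (1 / 2) ^ m j y))
    (Eventually.of_forall fun j y => (hdiam j y).trans (ENNReal.ofReal_le_ofReal ?_))
    (Eventually.of_forall hWu)).trans ?_
  · gcongr ?_ * ?_
    exact pow_le_pow_of_le_one (by norm_num) (by norm_num) (hmj j y y.2)
  · rw [← hlim.liminf_eq]
    refine liminf_le_liminf (Eventually.of_forall fun j => ?_)
    refine le_trans (ENNReal.tsum_le_tsum fun y => ?_) (hsum j)
    rw [ENNReal.rpow_one]
    exact hdiam j y

lemma exists_dyadic_radius {s : ℝ} (hs : 0 < s) {D e : ENNReal} (he : 0 < e) {M : ℕ}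
    (hD : D ≤ ENNReal.ofReal ((1 / 2) ^ (M + 2))) :
    ∃ n, M ≤ n ∧ D < ENNReal.ofReal ((1 / 2) ^ n) ∧
      ENNReal.ofReal ((1 / 2) ^ n) ^ s ≤ 4 ^ s * D ^ s + e := by
  rcases eq_or_ne D 0 with rfl | hD0
  · have hlim : Tendsto (fun n : ℕ => ENNReal.ofReal ((1 / 2) ^ n) ^ s) atTop (nhds 0) := by
      have h1 : Tendsto (fun n : ℕ => ENNReal.ofReal ((1 / 2) ^ n)) atTop (nhds 0) := by
        simpa using ENNReal.tendsto_ofReal (tendsto_pow_atTop_nhds_zero_of_lt_one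
          (show (0 : ℝ) ≤ 1 / 2 by norm_num) (by norm_num))
      simpa [hs] using h1.ennrpow_const s
    obtain ⟨n, hn, hMn⟩ := ((hlim.eventually_le_const he).and (eventually_ge_atTop M)).exists
    refine ⟨n, hMn, ?_, hn.trans le_add_self⟩
    rw [ENNReal.ofReal_pos]
    positivity
  · have hDtop : D ≠ ⊤ := (hD.trans_lt ENNReal.ofReal_lt_top).ne
    obtain ⟨d, hd, rfl⟩ : ∃ d : ℝ, 0 < d ∧ D = ENNReal.ofReal d :=
      ⟨D.toReal, ENNReal.toReal_pos hD0 hDtop, (ENNReal.ofReal_toReal hDtop).symm⟩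
    have hd' : d ≤ (1 / 2) ^ (M + 2) := (ENNReal.ofReal_le_ofReal_iff (by positivity)).1 hD
    have hM1 : ((1 : ℝ) / 2) ^ M ≤ 1 := pow_le_one₀ (by norm_num) (by norm_num)
    rw [pow_add] at hd'
    obtain ⟨n, hn1, hn2⟩ := exists_nat_pow_near_of_lt_one (x := 2 * d) (y := (1 / 2 : ℝ))
      (by positivity) (by linarith) (by norm_num) (by norm_num)
    have hn3 : ((1 : ℝ) / 2) ^ n < 4 * d := by rw [pow_succ] at hn1; linarith
    refine ⟨n, ?_, (ENNReal.ofReal_lt_ofReal_iff (by positivity)).2 (by linarith), ?_⟩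
    · have : ((1 : ℝ) / 2) ^ n ≤ (1 / 2) ^ M := by linarith
      exact (pow_le_pow_iff_right_of_lt_one₀ (by norm_num) (by norm_num)).1 this
    · refine le_trans ?_ le_self_add
      rw [← ENNReal.mul_rpow_of_nonneg _ _ hs.le]
      refine ENNReal.rpow_le_rpow ?_ hs.le
      rw [show (4 : ENNReal) = ENNReal.ofReal 4 by norm_num, ← ENNReal.ofReal_mul (by norm_num)]
      exact ENNReal.ofReal_le_ofReal hn3.le

lemma exists_dyadic_cover {X : Type*} [MetricSpace X] [MeasurableSpace X] [BorelSpace X]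
    {s : ℝ} (hs : 0 < s) {A : Set X} {a : ENNReal} (ha : μH[s] A < a) (M : ℕ) :
    ∃ 𝒱 : Set (X × ℕ), (∀ v ∈ 𝒱, v.1 ∈ A ∧ M ≤ v.2) ∧
      (∀ y ∈ A, ∃ v ∈ 𝒱, dist y v.1 < (1 / 2) ^ v.2) ∧
      ∑' v : 𝒱, ENNReal.ofReal ((1 / 2) ^ v.1.2) ^ s ≤ (4 ^ s + 1) * a := by
  obtain ⟨t, hAt, htr, hta⟩ : ∃ t : ℕ → Set X, A ⊆ ⋃ n, t n ∧
      (∀ n, ediam (t n) ≤ ENNReal.ofReal ((1 / 2) ^ (M + 2))) ∧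
      ∑' n, ⨆ _ : (t n).Nonempty, ediam (t n) ^ s < a := by
    rw [Measure.hausdorffMeasure_apply] at ha
    have h1 := (le_iSup₂ (f := fun (r : ENNReal) (_ : 0 < r) => ⨅ (t : ℕ → Set X)
      (_ : A ⊆ ⋃ n, t n) (_ : ∀ n, ediam (t n) ≤ r),
      ∑' n, ⨆ _ : (t n).Nonempty, ediam (t n) ^ s) (ENNReal.ofReal ((1 / 2) ^ (M + 2)))
      (by rw [ENNReal.ofReal_pos]; positivity)).trans_lt ha
    simp only [iInf_lt_iff] at h1
    obtain ⟨t, h1, h2, h3⟩ := h1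
    exact ⟨t, h1, h2, h3⟩
  obtain ⟨e, he, hea⟩ := ENNReal.exists_pos_sum_of_countable' (ne_bot_of_gt ha) ℕ
  have hstep : ∀ n, ∃ 𝒱 : Set (X × ℕ), (∀ v ∈ 𝒱, v.1 ∈ A ∧ M ≤ v.2) ∧
      (∀ y ∈ A, y ∈ t n → ∃ v ∈ 𝒱, dist y v.1 < (1 / 2) ^ v.2) ∧
      ∑' v : 𝒱, ENNReal.ofReal ((1 / 2) ^ v.1.2) ^ s
        ≤ 4 ^ s * (⨆ _ : (t n).Nonempty, ediam (t n) ^ s) + e n := by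
    intro n
    rcases (A ∩ t n).eq_empty_or_nonempty with h | ⟨c, hcA, hct⟩
    · refine ⟨∅, by simp, fun y hy hyt => ?_, by simp⟩
      have : y ∈ A ∩ t n := ⟨hy, hyt⟩
      simp [h] at this
    · obtain ⟨k, hMk, hDk, hk⟩ := exists_dyadic_radius hs (he n) (htr n)
      refine ⟨{(c, k)}, by simp [hcA, hMk], fun y _ hyt => ⟨(c, k), rfl, ?_⟩, ?_⟩
      · have h1 := (edist_le_ediam_of_mem hyt hct).trans_lt hDk
        rw [edist_dist] at h1
        exact (ENNReal.ofReal_lt_ofReal_iff (by positivity)).1 h1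
      · rw [tsum_singleton (c, k) fun v : X × ℕ => ENNReal.ofReal ((1 / 2) ^ v.2) ^ s,
          iSup_pos ⟨c, hct⟩]
        exact hk
  choose 𝒱 h1 h2 h3 using hstep
  refine ⟨⋃ n, 𝒱 n, fun v hv => ?_, fun y hy => ?_, ?_⟩
  · obtain ⟨n, hn⟩ := mem_iUnion.1 hv
    exact h1 n v hn
  · obtain ⟨n, hn⟩ := mem_iUnion.1 (hAt hy)
    obtain ⟨v, hv, hyv⟩ := h2 n y hy hn
    exact ⟨v, mem_iUnion.2 ⟨n, hv⟩, hyv⟩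
  · refine (ENNReal.tsum_iUnion_le_tsum
      (fun v : X × ℕ => ENNReal.ofReal ((1 / 2) ^ v.2) ^ s) 𝒱).trans ?_
    refine (ENNReal.tsum_le_tsum h3).trans ?_
    rw [ENNReal.tsum_add, ENNReal.tsum_mul_left, add_mul, one_mul]
    gcongr

theorem IsScaleFamily.hausdorffMeasure_ne_zero {V : Type*} [NormedAddCommGroup V]
    [InnerProductSpace ℝ V] [Nontrivial V] [TopologicalSpace.SeparableSpace V]
    [MeasurableSpace V] [BorelSpace V] {K W E : Set V} {b : ℝ} {f : ℕ → V → ℝ}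
    (hf : IsScaleFamily K b f) (hK : IsCompact K) (hc : IsPreconnected K) (hb : 0 < b)
    (hb1 : b < 1) {N : ℕ} (hN : 32 ≤ N) (hNb : 2 ^ 55 < N * b ^ 2) {θ : ℝ} (hθ : 0 ≤ θ)
    (hθN : θ * (N + 38) ≤ 1) {κ : ℝ} (hκ : 0 ≤ κ) (hKWE : K = W ∪ E) (hE : μH[1] E < ⊤)
    (hW : 0 < μH[1] W) (hout : ∀ x ∈ K, ∃ y ∈ K, 1 / 4 < dist y x)
    (hWκ : ∀ x ∈ W, ∃ q₀ : ℕ, ∀ q, q₀ ≤ q → κ * q ≤ scaleSum f q x) :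
    μH[1 + θ * κ] K ≠ 0 := by
  classical
  intro hzero
  have hWK : W ⊆ K := hKWE ▸ subset_union_left
  have hcont : ∀ q, Continuous (scaleSum f q) := fun q =>
    (LipschitzWith.of_le_add_mul' ((2 : ℝ) ^ q) fun y z => hf.sum_lip q y z).continuous
  set L : ℕ → Set V := fun q => K ∩ ⋂ q' ≥ q, {y | κ * q' ≤ scaleSum f q' y} with hL
  have hLmem : ∀ q y, y ∈ L q ↔ y ∈ K ∧ ∀ q', q ≤ q' → κ * q' ≤ scaleSum f q' y := by
    intro q y
    simp [hL]
  have hLclosed : ∀ q, IsClosed (L q) := fun q => hK.isClosed.inter <|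
    isClosed_biInter fun q' _ => isClosed_le continuous_const (hcont q')
  set E' := K \ ⋃ q, L q with hE'
  have hE'meas : MeasurableSet E' :=
    hK.isClosed.measurableSet.diff (MeasurableSet.iUnion fun q => (hLclosed q).measurableSet)
  have hWL : W ⊆ ⋃ q, L q := fun x hx => by
    obtain ⟨q, hq⟩ := hWκ x hx
    exact mem_iUnion.2 ⟨q, (hLmem q x).2 ⟨hWK hx, hq⟩⟩
  have hE'E : E' ⊆ E := by
    rintro y ⟨hy, hyL⟩
    rw [hKWE] at hy
    exact hy.resolve_left fun h => hyL (hWL h)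
  obtain ⟨x, hxW, m, hm, hx⟩ := exists_closedBall_hausdorffMeasure_le hE'meas
    ((measure_mono hE'E).trans_lt hE) (disjoint_left.2 fun y hy hyE => hyE.2 (hWL hy)) hW
    (ε := (1 / 2) ^ 40) (by positivity) 2
  have hxK := hWK hxW
  set e := Real.exp (-(θ * scaleSum f m x)) with he
  have hepos : 0 < e := Real.exp_pos _
  have hwx : scaleWeight f θ (x, m) = (1 / 2) ^ m * e := rfl
  set w := scaleWeight f θ (x, m) with hw
  have hwpos : 0 < w := by rw [hwx]; positivity
  set g : V × ℕ → ENNReal := fun v => ENNReal.ofReal (scaleWeight f θ v) with hg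
  obtain ⟨𝒱, h𝒱, h𝒱cov, h𝒱sum⟩ := exists_dyadic_cover (s := 1) one_pos
    (a := ENNReal.ofReal (2 * ((1 / 2) ^ 40 * (1 / 2) ^ m))) (hx.trans_lt (by
      rw [ENNReal.ofReal_lt_ofReal_iff (by positivity)]
      linarith [show (0 : ℝ) < (1 / 2) ^ 40 * (1 / 2) ^ m by positivity])) m
  have h𝒱g : ∑' v : 𝒱, g v ≤ ENNReal.ofReal ((1 / 2) ^ 34 * w) := by
    calc ∑' v : 𝒱, g v
        ≤ ∑' v : 𝒱, ENNReal.ofReal (3 * e) * ENNReal.ofReal ((1 / 2) ^ v.1.2) ^ (1 : ℝ) := by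
          refine ENNReal.tsum_le_tsum fun v => ?_
          obtain ⟨⟨-, hvx⟩, hmv⟩ := h𝒱 v v.2
          rw [ENNReal.rpow_one, ← ENNReal.ofReal_mul (by positivity)]
          refine ENNReal.ofReal_le_ofReal ?_
          have h1 : scaleSum f m x ≤ scaleSum f v.1.2 v.1.1 + 1 :=
            (hf.sum_le_add (z := v.1.1) (by rw [dist_comm, one_mul]; exact hvx)).trans
              (by gcongr; exact hf.sum_mono hmv _)
          have h2 := exp_neg_mul_le hθ h1 (by nlinarith)
          rw [scaleWeight, mul_comm]
          gcongr
      _ ≤ ENNReal.ofReal (3 * e) *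
          ((4 ^ (1 : ℝ) + 1) * ENNReal.ofReal (2 * ((1 / 2) ^ 40 * (1 / 2) ^ m))) := by
          rw [ENNReal.tsum_mul_left]
          gcongr
      _ = ENNReal.ofReal (3 * e * (5 * (2 * ((1 / 2) ^ 40 * (1 / 2) ^ m)))) := by
          rw [ENNReal.ofReal_mul (p := 3 * e) (by positivity),
            ENNReal.ofReal_mul (p := 5) (by norm_num), ENNReal.rpow_one,
            show (4 + 1 : ENNReal) = ENNReal.ofReal 5 by norm_num]
      _ ≤ _ := by
          refine ENNReal.ofReal_le_ofReal ?_
          rw [hwx]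
          have : 0 < (1 / 2 : ℝ) ^ m * e := by positivity
          norm_num at this ⊢
          nlinarith
  set s := 1 + θ * κ with hs
  have hs0 : 0 < s := by positivity
  have hC : (4 : ENNReal) ^ s + 1 ≠ ⊤ := by
    simp [ENNReal.rpow_eq_top_iff]
  obtain ⟨a, ha, hasum⟩ := ENNReal.exists_pos_sum_of_countable'
    (ε := ENNReal.ofReal ((1 / 2) ^ 34 * w) / (4 ^ s + 1))
    (ENNReal.div_ne_zero.2 ⟨(ENNReal.ofReal_pos.2 (by positivity)).ne', hC⟩) ℕ
  have hcovL : ∀ q, ∃ 𝒲 : Set (V × ℕ), (∀ v ∈ 𝒲, v.1 ∈ L q ∧ q ≤ v.2) ∧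
      (∀ y ∈ L q, ∃ v ∈ 𝒲, dist y v.1 < (1 / 2) ^ v.2) ∧
      ∑' v : 𝒲, ENNReal.ofReal ((1 / 2) ^ v.1.2) ^ s ≤ (4 ^ s + 1) * a q := fun q =>
    exists_dyadic_cover hs0 (by
      rw [measure_mono_null inter_subset_left hzero]
      exact ha q) q
  choose 𝒲 h𝒲 h𝒲cov h𝒲sum using hcovL
  have h𝒲g : ∑' v : ⋃ q, 𝒲 q, g v ≤ ENNReal.ofReal ((1 / 2) ^ 34 * w) := by
    refine (ENNReal.tsum_iUnion_le_tsum g 𝒲).trans ?_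
    calc ∑' q, ∑' v : 𝒲 q, g v ≤ ∑' q, (4 ^ s + 1) * a q := by
          refine ENNReal.tsum_le_tsum fun q => le_trans (ENNReal.tsum_le_tsum fun v => ?_) (h𝒲sum q)
          obtain ⟨hvL, hqv⟩ := h𝒲 q v v.2
          have h1 := ((hLmem _ _).1 hvL).2 v.1.2 hqv
          have hpos : (0 : ℝ) < (1 / 2) ^ v.1.2 := by positivity
          rw [ENNReal.ofReal_rpow_of_nonneg hpos.le hs0.le]
          refine ENNReal.ofReal_le_ofReal ?_
          rw [scaleWeight, hs, Real.rpow_add hpos, Real.rpow_one, Real.rpow_def_of_pos hpos]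
          gcongr
          rw [Real.log_pow, one_div, Real.log_inv]
          have h2 : Real.log 2 ≤ 1 := Real.log_two_lt_d9.le.trans (by norm_num)
          have h3 := mul_le_mul_of_nonneg_left h1 hθ
          have h4 : 0 ≤ θ * (κ * v.1.2) := by positivity
          nlinarith
      _ ≤ (4 ^ s + 1) * (ENNReal.ofReal ((1 / 2) ^ 34 * w) / (4 ^ s + 1)) := by
          rw [ENNReal.tsum_mul_left]
          gcongr
      _ ≤ _ := ENNReal.mul_div_le
  have hUsub : K ∩ closedBall x ((1 / 2) ^ m)
      ⊆ ⋃ v ∈ 𝒱 ∪ ⋃ q, 𝒲 q, ball v.1 ((1 / 2 : ℝ) ^ v.2) := by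
    rintro y ⟨hy, hyx⟩
    by_cases hyL : y ∈ ⋃ q, L q
    · obtain ⟨q, hq⟩ := mem_iUnion.1 hyL
      obtain ⟨v, hv, hyv⟩ := h𝒲cov q y hq
      exact mem_iUnion₂.2 ⟨v, Or.inr (mem_iUnion.2 ⟨q, hv⟩), hyv⟩
    · obtain ⟨v, hv, hyv⟩ := h𝒱cov y ⟨⟨hy, hyL⟩, hyx⟩
      exact mem_iUnion₂.2 ⟨v, Or.inl hv, hyv⟩
  obtain ⟨F, hFsub, hFfin, hFcov⟩ := (hK.inter_right isClosed_closedBall).elim_finite_subcover_image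
    (fun _ _ => isOpen_ball) hUsub
  have hFK : ∀ v ∈ hFfin.toFinset, v.1 ∈ K := by
    intro v hv
    rcases hFsub (hFfin.mem_toFinset.1 hv) with h | h
    · exact (h𝒱 v h).1.1.1
    · obtain ⟨q, hq⟩ := mem_iUnion.1 h
      exact (h𝒲 q v hq).1.1
  have hmain := hf.scaleWeight_le_sum hK hc hb hb1 hN hNb hθ hθN hFK hxK (m := m) (by
      obtain ⟨y, hy, hyx⟩ := hout x hxK
      refine ⟨y, hy, lt_of_le_of_lt ?_ hyx⟩
      calc ((1 : ℝ) / 2) ^ m ≤ (1 / 2) ^ 2 :=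
            pow_le_pow_of_le_one (by norm_num) (by norm_num) hm
        _ = 1 / 4 := by norm_num) (by
      intro y hy hyx
      obtain ⟨v, hv, hyv⟩ := mem_iUnion₂.1 (hFcov ⟨hy, hyx⟩)
      exact ⟨v, hFfin.mem_toFinset.2 hv, (mem_ball.1 hyv).le⟩)
  have hsumF : ENNReal.ofReal (∑ v ∈ hFfin.toFinset, scaleWeight f θ v)
      ≤ ENNReal.ofReal ((1 / 2) ^ 34 * w + (1 / 2) ^ 34 * w) := by
    rw [ENNReal.ofReal_sum_of_nonneg fun v _ => scaleWeight_nonneg f θ v,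
      ENNReal.ofReal_add (by positivity) (by positivity)]
    calc ∑ v ∈ hFfin.toFinset, g v = ∑' v : (hFfin.toFinset : Set (V × ℕ)), g v :=
          (Finset.tsum_subtype' _ _).symm
      _ ≤ ∑' v : ↑(𝒱 ∪ ⋃ q, 𝒲 q), g v :=
          ENNReal.tsum_mono_subtype g (by rwa [hFfin.coe_toFinset])
      _ ≤ _ := (ENNReal.tsum_union_le g _ _).trans (add_le_add h𝒱g h𝒲g)
  have hfinal := (ENNReal.ofReal_le_ofReal_iff (by positivity)).1 hsumF
  norm_num at hfinal hmain
  linarith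

/-! ### The dimension bound -/

lemma exists_nat_mul_sq_gt {β : ℝ} (hβ : β ∈ Ioo (0 : ℝ) 1) :
    ∃ N : ℕ, 32 ≤ N ∧ 2 ^ 55 < N * (β / 4) ^ 2 ∧ ((N : ℝ) + 38) * β ^ 2 ≤ 2 ^ 60 := by
  obtain ⟨h0, h1⟩ := hβ
  have hβ2 : 0 < β ^ 2 := by positivity
  have hβ1 : β ^ 2 ≤ 1 := pow_le_one₀ h0.le h1.le
  have hc := Nat.le_ceil ((2 : ℝ) ^ 59 / β ^ 2)
  have hc' := Nat.ceil_lt_add_one (show (0 : ℝ) ≤ 2 ^ 59 / β ^ 2 by positivity)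
  refine ⟨⌈(2 : ℝ) ^ 59 / β ^ 2⌉₊ + 32, Nat.le_add_left _ _, ?_, ?_⟩
  · rw [div_le_iff₀ hβ2] at hc
    push_cast
    nlinarith
  · rw [← sub_lt_iff_lt_add, lt_div_iff₀ hβ2] at hc'
    push_cast
    nlinarith

lemma exists_half_rpow_eq {lam : ℝ} (h : lam ∈ Ioo (0 : ℝ) 1) :
    ∃ T : ℝ, 0 < T ∧ lam = (1 / 2) ^ T ∧ lam * (1 + T) ≤ 2 := by
  obtain ⟨h0, h1⟩ := h
  have hl2 : 1 / 2 < Real.log 2 := by linarith [Real.log_two_gt_d9]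
  have hlog : Real.log lam < 0 := Real.log_neg h0 h1
  refine ⟨-Real.log lam / Real.log 2, div_pos (by linarith) (by linarith), ?_, ?_⟩
  · rw [Real.rpow_def_of_pos (by norm_num), one_div, Real.log_inv, neg_mul,
      mul_div_cancel₀ _ (by linarith), neg_neg, Real.exp_log h0]
  · have h2 : lam * -Real.log lam ≤ 1 - lam := by
      have h3 := Real.log_le_sub_one_of_pos (inv_pos.2 h0)
      rw [Real.log_inv] at h3
      calc lam * -Real.log lam ≤ lam * (lam⁻¹ - 1) := by gcongr
        _ = 1 - lam := by field_simp
    have h4 : lam * (-Real.log lam / Real.log 2) ≤ 2 * (1 - lam) := by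
      rw [mul_div_assoc', div_le_iff₀ (by linarith)]
      nlinarith
    linarith

lemma exists_dist_gt_of_diam_eq_one {X : Type*} [MetricSpace X] {K : Set X} (hK : diam K = 1)
    (x : X) : ∃ y ∈ K, 1 / 4 < dist y x := by
  by_contra! h
  have h1 : diam K ≤ 1 / 2 := diam_le_of_forall_dist_le (by norm_num) fun y hy z hz => by
    linarith [dist_triangle_right y z x, h y hy, h z hz]
  linarith

open scoped Classical in
/-- a continuum `K = W ∪ E` of diameter 1 with `H¹(E) < ∞`,
`H¹(W) > 0`, which is mean wiggly at every point of `W` with uniform parameters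
`λ, κ, β₀ ∈ (0,1)`, satisfies `dim_H(K) ≥ 1 + c'·λ⁴·β₀²·κ` with `c'` universal. -/
theorem dimH_ge_of_mean_wiggly :
    ∃ c' : ℝ, 0 < c' ∧
      ∀ (d : ℕ), 2 ≤ d →
      ∀ (K W E : Set (EuclideanSpace ℝ (Fin d))) (lam κ β₀ : ℝ),
        IsCompact K → IsConnected K → Metric.diam K = 1 →
        K = W ∪ E → μH[1] E < ⊤ → 0 < μH[1] W →
        lam ∈ Ioo (0 : ℝ) 1 → κ ∈ Ioo (0 : ℝ) 1 → β₀ ∈ Ioo (0 : ℝ) 1 →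
        (∀ x ∈ W, MeanWiggly K x lam κ β₀) →
        ENNReal.ofReal (1 + c' * lam ^ 4 * β₀ ^ 2 * κ) ≤ dimH K := by
  refine ⟨(1 / 2) ^ 62, by positivity, ?_⟩
  intro d hd K W E lam κ β hK hconn hdiam hKWE hE hW hlam hκ hβ hwig
  have : Nonempty (Fin d) := ⟨⟨0, by omega⟩⟩
  obtain ⟨N, hN, hNb, hNβ⟩ := exists_nat_mul_sq_gt hβ
  obtain ⟨T, hT, hlamT, hT2⟩ := exists_half_rpow_eq hlam
  obtain ⟨hκ0, -⟩ := hκ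
  obtain ⟨hβ0, hβ1⟩ := id hβ
  obtain ⟨hl0, hl1⟩ := id hlam
  set θ : ℝ := 1 / (N + 38) with hθ
  set κ' : ℝ := κ / (2 * (1 + T)) with hκ'
  have hθ0 : 0 < θ := by positivity
  have hκ'0 : 0 < κ' := by positivity
  have hWK : W ⊆ K := hKWE ▸ subset_union_left
  have hne := (isScaleFamily_farFun K (β / 4)).hausdorffMeasure_ne_zero hK hconn.isPreconnected
    (by positivity) (by linarith) hN hNb hθ0.le (one_div_mul_cancel (by positivity)).le hκ'0.le
    hKWE hE hW (fun x _ => exists_dist_gt_of_diam_eq_one hdiam x)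
    fun x hx => (hwig x hx).eventually_le_scaleSum (hWK hx) hlam hκ0 hβ0 hT hlamT
  have hdim : ENNReal.ofReal (1 + θ * κ') ≤ dimH K := by
    by_contra! hlt
    refine hne ?_
    have := hausdorffMeasure_of_dimH_lt (d := Real.toNNReal (1 + θ * κ')) hlt
    rwa [Real.coe_toNNReal _ (by positivity)] at this
  refine le_trans (ENNReal.ofReal_le_ofReal ?_) hdim
  have hθβ : (1 / 2) ^ 60 * β ^ 2 ≤ θ := by
    rw [hθ, le_div_iff₀ (by positivity)]
    norm_num at hNβ ⊢
    linarith
  have hκl : lam * κ / 4 ≤ κ' := by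
    rw [hκ', le_div_iff₀ (by positivity)]
    nlinarith
  have hl4 : lam ^ 4 ≤ lam := by
    simpa using pow_le_pow_of_le_one hl0.le hl1.le (show 1 ≤ 4 by norm_num)
  gcongr 1 + ?_
  calc (1 / 2) ^ 62 * lam ^ 4 * β ^ 2 * κ ≤ (1 / 2) ^ 62 * lam * β ^ 2 * κ := by gcongr
    _ = ((1 / 2) ^ 60 * β ^ 2) * (lam * κ / 4) := by ring
    _ ≤ θ * κ' := by gcongr
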